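/- arXiv:1407.5942 — 4 statements merged into one kernel-verified Lean document; each statement's English description precedes it below -/
import Mathlib

section
/- Let u be a C³ solution of the heat equation u_t = u_xx on [0,1]×[0,T] with u(0,t) = u(1,t) = 0. Let u^m be a crystalline discrete solution on an interval I ⊆ [0,T] for W(p) = p²/2 (so Δ_i = (s_{i+1} − s_{i−1})/2), with auxiliary slopes s_0 = s_2 and s_{N+1} = s_{N−1}, boundary conditions v_1 = v_N = 0, and interior evolution v_i = Δ_i/l_i = (s_{i+1} − s_{i−1})/(2 l_i) for 2 ≤ i ≤ N−1. Let m ≥ max_{1 ≤ i ≤ N+1} |s_i − s_{i−1}|. Then for every t ∈ I, (d/dt)[(1/2)∫₀¹ |u_x(x,t) − u_x^m(x,t)|² dx] ≤ −∫₀¹ |u_t(x,t) − u_t^m(x,t)|² dx + (1/2) m ‖u_{xxx}(·,t)‖_{L∞([0,1])}. -/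
open Set MeasureTheory

/-- A crystalline discrete solution on a time interval `I`. -/
structure CrystSol (I : Set ℝ) where
  /-- number of faces -/
  N : ℕ
  hN : 2 ≤ N
  /-- slopes of the faces -/
  s : ℕ → ℝ
  /-- corner positions -/
  x : ℕ → ℝ → ℝ
  /-- face velocities -/
  v : ℕ → ℝ → ℝ
  /-- the piecewise linear function `u^m` -/
  um : ℝ → ℝ → ℝ
  hs : ∀ i, 1 ≤ i → i + 1 ≤ N → s i ≠ s (i + 1)
  hx0 : ∀ t ∈ I, x 0 t = 0
  hxN : ∀ t ∈ I, x N t = 1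
  hmono : ∀ t ∈ I, ∀ i, i + 1 ≤ N → x i t < x (i + 1) t
  hvC1 : ∀ i, 1 ≤ i → i ≤ N → ContDiffOn ℝ 1 (v i) I
  hcorner : ∀ t ∈ I, ∀ i, 1 ≤ i → i + 1 ≤ N →
    HasDerivWithinAt (x i) (-((v (i + 1) t - v i t) / (s (i + 1) - s i))) I t
  haff : ∀ t ∈ I, ∀ i, 1 ≤ i → i ≤ N → ∀ ξ ∈ Icc (x (i - 1) t) (x i t),
    um ξ t = um (x (i - 1) t) t + s i * (ξ - x (i - 1) t)
  hvel : ∀ t ∈ I, ∀ i, 1 ≤ i → i ≤ N → ∀ ξ ∈ Ioo (x (i - 1) t) (x i t),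
    HasDerivWithinAt (fun τ => um ξ τ) (v i t) I t

/-- The length of the (projection of the) `i`-th face. -/
def CrystSol.len {I : Set ℝ} (S : CrystSol I) (i : ℕ) (t : ℝ) : ℝ :=
  S.x i t - S.x (i - 1) t

/-- The quantity `Δ_i`: the second divided difference of `W` at `s_{i-1}, s_i, s_{i+1}`. -/
noncomputable def secondDD (W : ℝ → ℝ) (s : ℕ → ℝ) (i : ℕ) : ℝ :=
  (W (s (i + 1)) - W (s i)) / (s (i + 1) - s i) -
    (W (s i) - W (s (i - 1))) / (s i - s (i - 1))


/-- A `C³` function `u` on `[0,1] × [0,T]` together with its relevant partial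
derivatives `u_x`, `u_xx`, `u_xxx`, `u_t`, `u_xt`, all continuous. -/
structure C3Sol (T : ℝ) where
  u : ℝ → ℝ → ℝ
  ux : ℝ → ℝ → ℝ
  uxx : ℝ → ℝ → ℝ
  uxxx : ℝ → ℝ → ℝ
  ut : ℝ → ℝ → ℝ
  uxt : ℝ → ℝ → ℝ
  hux : ∀ t ∈ Icc (0:ℝ) T, ∀ ξ ∈ Icc (0:ℝ) 1,
    HasDerivWithinAt (fun a => u a t) (ux ξ t) (Icc 0 1) ξ
  huxx : ∀ t ∈ Icc (0:ℝ) T, ∀ ξ ∈ Icc (0:ℝ) 1,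
    HasDerivWithinAt (fun a => ux a t) (uxx ξ t) (Icc 0 1) ξ
  huxxx : ∀ t ∈ Icc (0:ℝ) T, ∀ ξ ∈ Icc (0:ℝ) 1,
    HasDerivWithinAt (fun a => uxx a t) (uxxx ξ t) (Icc 0 1) ξ
  hut : ∀ ξ ∈ Icc (0:ℝ) 1, ∀ t ∈ Icc (0:ℝ) T,
    HasDerivWithinAt (fun τ => u ξ τ) (ut ξ t) (Icc 0 T) t
  huxt : ∀ ξ ∈ Icc (0:ℝ) 1, ∀ t ∈ Icc (0:ℝ) T,
    HasDerivWithinAt (fun τ => ux ξ τ) (uxt ξ t) (Icc 0 T) t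
  hcont_u : ContinuousOn (fun q : ℝ × ℝ => u q.1 q.2) (Icc 0 1 ×ˢ Icc 0 T)
  hcont_ux : ContinuousOn (fun q : ℝ × ℝ => ux q.1 q.2) (Icc 0 1 ×ˢ Icc 0 T)
  hcont_uxx : ContinuousOn (fun q : ℝ × ℝ => uxx q.1 q.2) (Icc 0 1 ×ˢ Icc 0 T)
  hcont_uxxx : ContinuousOn (fun q : ℝ × ℝ => uxxx q.1 q.2) (Icc 0 1 ×ˢ Icc 0 T)
  hcont_ut : ContinuousOn (fun q : ℝ × ℝ => ut q.1 q.2) (Icc 0 1 ×ˢ Icc 0 T)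
  hcont_uxt : ContinuousOn (fun q : ℝ × ℝ => uxt q.1 q.2) (Icc 0 1 ×ˢ Icc 0 T)

/-- `uxm` is the spatial derivative of the discrete solution: it equals the face slope
`s_i` on the interior of each face. -/
def SlopeLink {I : Set ℝ} (S : CrystSol I) (uxm : ℝ → ℝ → ℝ) : Prop :=
  ∀ t ∈ I, ∀ i, 1 ≤ i → i ≤ S.N →
    ∀ ξ ∈ Set.Ioo (S.x (i - 1) t) (S.x i t), uxm ξ t = S.s i

/-- `utm` is the time derivative of the discrete solution: it equals the face velocity
`v_i` on the interior of each face. -/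
def VelLink {I : Set ℝ} (S : CrystSol I) (utm : ℝ → ℝ → ℝ) : Prop :=
  ∀ t ∈ I, ∀ i, 1 ≤ i → i ≤ S.N →
    ∀ ξ ∈ Set.Ioo (S.x (i - 1) t) (S.x i t), utm ξ t = S.v i t

/-- The discrete solution `S` agrees with the global function `um` on `[0,1]`. -/
def UmLink {I : Set ℝ} (S : CrystSol I) (um : ℝ → ℝ → ℝ) : Prop :=
  ∀ t ∈ I, ∀ ξ ∈ Set.Icc (0:ℝ) 1, S.um ξ t = um ξ t

open Filter Topology

theorem hasDerivWithinAt_intervalIntegral_of_continuousOn {f f' : ℝ → ℝ → ℝ} {a b c d t : ℝ}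
    (hab : a ≤ b) (ht : t ∈ Icc c d)
    (hf : ContinuousOn (fun q : ℝ × ℝ => f q.1 q.2) (Icc a b ×ˢ Icc c d))
    (hf' : ContinuousOn (fun q : ℝ × ℝ => f' q.1 q.2) (Icc a b ×ˢ Icc c d))
    (hd : ∀ ξ ∈ Icc a b, ∀ τ ∈ Icc c d,
      HasDerivWithinAt (fun τ => f ξ τ) (f' ξ τ) (Icc c d) τ) :
    HasDerivWithinAt (fun σ => ∫ ξ in a..b, f ξ σ) (∫ ξ in a..b, f' ξ t) (Icc c d) t := by
  have hslice : ∀ σ ∈ Icc c d, ContinuousOn (fun ξ => f ξ σ) (Icc a b) := fun σ hσ =>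
    hf.comp (Continuous.prodMk_left σ).continuousOn fun ξ hξ => ⟨hξ, hσ⟩
  obtain ⟨C, hC⟩ := (isCompact_Icc.prod isCompact_Icc).exists_bound_of_continuousOn hf'
  have hsub : uIoc a b ⊆ Icc a b := uIoc_of_le hab ▸ Ioc_subset_Icc_self
  have hmem : ∀ᶠ σ in 𝓝[Icc c d \ {t}] t, σ ∈ Icc c d \ {t} := self_mem_nhdsWithin
  rw [hasDerivWithinAt_iff_tendsto_slope]
  have hslope : (fun σ => ∫ ξ in a..b, slope (fun τ => f ξ τ) t σ) =ᶠ[𝓝[Icc c d \ {t}] t]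
      slope (fun σ => ∫ ξ in a..b, f ξ σ) t := by
    filter_upwards [hmem] with σ hσ
    have hi : ∀ τ ∈ Icc c d, IntervalIntegrable (fun ξ => f ξ τ) volume a b := fun τ hτ =>
      (hslice τ hτ).intervalIntegrable_of_Icc hab
    simp only [slope_def_module, smul_eq_mul]
    rw [intervalIntegral.integral_const_mul,
      intervalIntegral.integral_sub (hi σ hσ.1) (hi t ht)]
  refine Tendsto.congr' hslope ?_
  refine intervalIntegral.tendsto_integral_filter_of_dominated_convergence (fun _ => C) ?_ ?_
    intervalIntegrable_const ?_
  · filter_upwards [hmem] with σ hσ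
    have hcont : ContinuousOn (fun ξ => slope (fun τ => f ξ τ) t σ) (Icc a b) := by
      simp only [slope_def_module, smul_eq_mul]
      exact continuousOn_const.mul ((hslice σ hσ.1).sub (hslice t ht))
    exact (hcont.aestronglyMeasurable measurableSet_Icc).mono_set hsub
  · filter_upwards [hmem] with σ hσ
    refine Eventually.of_forall fun ξ hξ => ?_
    have hle := (convex_Icc c d).norm_image_sub_le_of_norm_hasDerivWithin_le
      (hd ξ (hsub hξ)) (fun τ hτ => hC (ξ, τ) ⟨hsub hξ, hτ⟩) ht hσ.1
    have hpos : 0 < ‖σ - t‖ := norm_pos_iff.2 (sub_ne_zero.2 hσ.2)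
    rw [slope_def_field, norm_div]
    exact (div_le_iff₀ hpos).2 hle
  · refine Eventually.of_forall fun ξ hξ => ?_
    exact hasDerivWithinAt_iff_tendsto_slope.1 (hd ξ (hsub hξ) t ht)

/-- Chain rule along a moving point, from continuity of the space derivative. -/
theorem hasDerivWithinAt_comp_moving_point {u ux : ℝ → ℝ → ℝ} {y : ℝ → ℝ} {a b c d t ut w : ℝ}
    {I : Set ℝ} (hI : I ⊆ Icc c d) (ht : t ∈ I)
    (hux : ∀ τ ∈ Icc c d, ∀ ξ ∈ Icc a b,
      HasDerivWithinAt (fun ζ => u ζ τ) (ux ξ τ) (Icc a b) ξ)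
    (hcont : ContinuousOn (fun q : ℝ × ℝ => ux q.1 q.2) (Icc a b ×ˢ Icc c d))
    (hut : HasDerivWithinAt (fun τ => u (y t) τ) ut (Icc c d) t)
    (hy : HasDerivWithinAt y w I t) (hmem : ∀ τ ∈ I, y τ ∈ Icc a b) :
    HasDerivWithinAt (fun τ => u (y τ) τ) (ut + ux (y t) t * w) I t := by
  have key : HasDerivWithinAt
      (fun τ => u (y τ) τ - u (y t) τ - ux (y t) t * (y τ - y t)) 0 I t := by
    rw [hasDerivWithinAt_iff_isLittleO]
    have hO : (fun τ => y τ - y t) =O[𝓝[I] t] fun τ => τ - t :=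
      (HasDerivAtFilter.isBigO_sub hy).comp_tendsto (tendsto_id.prodMk tendsto_const_pure)
    refine Asymptotics.IsLittleO.trans_isBigO ?_ hO
    rw [Asymptotics.isLittleO_iff]
    intro ε hε
    have hc := Metric.continuousWithinAt_iff.1 (hcont (y t, t) ⟨hmem t ht, hI ht⟩) ε hε
    obtain ⟨δ, hδ, hball⟩ := hc
    have hyδ : ∀ᶠ τ in 𝓝[I] t, dist (y τ) (y t) < δ :=
      hy.continuousWithinAt.eventually (Metric.ball_mem_nhds _ hδ)
    have htδ : ∀ᶠ τ in 𝓝[I] t, dist τ t < δ :=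
      nhdsWithin_le_nhds (Metric.ball_mem_nhds _ hδ)
    filter_upwards [hyδ, htδ, self_mem_nhdsWithin] with τ h1 h2 h3
    have hseg : uIcc (y t) (y τ) ⊆ Icc a b := uIcc_subset_Icc (hmem t ht) (hmem τ h3)
    have hD : ∀ ζ ∈ uIcc (y t) (y τ),
        HasDerivWithinAt (fun ζ => u ζ τ - ux (y t) t * ζ) (ux ζ τ - ux (y t) t)
          (uIcc (y t) (y τ)) ζ := fun ζ hζ =>
      (((hux τ (hI h3) ζ (hseg hζ)).mono hseg).fun_sub
        ((hasDerivWithinAt_id ζ _).const_mul (ux (y t) t))).congr_deriv (by simp)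
    have hB : ∀ ζ ∈ uIcc (y t) (y τ), ‖ux ζ τ - ux (y t) t‖ ≤ ε := fun ζ hζ => by
      have hζd : dist (ζ, τ) (y t, t) < δ := by
        rw [Prod.dist_eq]
        refine max_lt (lt_of_le_of_lt ?_ h1) h2
        rw [Real.dist_eq, Real.dist_eq]
        exact abs_sub_left_of_mem_uIcc hζ
      exact (hball (x := (ζ, τ)) ⟨hseg hζ, hI h3⟩ hζd).le
    have := (convex_uIcc (y t) (y τ)).norm_image_sub_le_of_norm_hasDerivWithin_le hD hB
      left_mem_uIcc right_mem_uIcc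
    convert this using 2
    simp
    ring
  have hsum := (key.add (hut.mono hI)).add ((hy.sub_const (y t)).const_mul (ux (y t) t))
  exact (hsum.congr_deriv (by ring)).congr (fun τ _ => by simp only [Pi.add_apply]; ring) (by simp)

theorem abs_sub_sub_mul_le {p q r : ℝ → ℝ} {a b L : ℝ} (hab : a ≤ b)
    (hp : ∀ ξ ∈ Icc a b, HasDerivWithinAt p (q ξ) (Icc a b) ξ)
    (hq : ∀ ξ ∈ Icc a b, HasDerivWithinAt q (r ξ) (Icc a b) ξ)
    (hr : ∀ ξ ∈ Icc a b, |r ξ| ≤ L) {c : ℝ} (hc : c = a ∨ c = b) :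
    |p b - p a - q c * (b - a)| ≤ L * (b - a) ^ 2 / 2 := by
  have hcm : c ∈ Icc a b := by rcases hc with rfl | rfl <;> simp [hab]
  have hqc : ContinuousOn q (Icc a b) := fun ξ hξ => (hq ξ hξ).continuousWithinAt
  have hqi : IntervalIntegrable q volume a b := hqc.intervalIntegrable_of_Icc hab
  have hFTC : ∫ ξ in a..b, q ξ = p b - p a :=
    intervalIntegral.integral_eq_sub_of_hasDerivAt_of_le hab
      (fun ξ hξ => (hp ξ hξ).continuousWithinAt)
      (fun ξ hξ => (hp ξ (Ioo_subset_Icc_self hξ)).hasDerivAt (Icc_mem_nhds hξ.1 hξ.2)) hqi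
  have hrep : p b - p a - q c * (b - a) = ∫ ξ in a..b, (q ξ - q c) := by
    rw [intervalIntegral.integral_sub hqi intervalIntegrable_const, hFTC,
      intervalIntegral.integral_const, smul_eq_mul, mul_comm]
  have hbound : ∀ ξ ∈ Ioc a b, ‖q ξ - q c‖ ≤ L * |ξ - c| := fun ξ hξ =>
    (convex_Icc a b).norm_image_sub_le_of_norm_hasDerivWithin_le hq hr hcm
      (Ioc_subset_Icc_self hξ)
  have hint : ∫ ξ in a..b, L * |ξ - c| = L * (b - a) ^ 2 / 2 := by
    rw [intervalIntegral.integral_const_mul]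
    rcases hc with rfl | rfl
    · have : ∫ ξ in c..b, |ξ - c| = ∫ ξ in c..b, (ξ - c) :=
        intervalIntegral.integral_congr fun ξ hξ => by
          rw [uIcc_of_le hab] at hξ
          exact abs_of_nonneg (sub_nonneg.2 hξ.1)
      rw [this, intervalIntegral.integral_sub (by simp) (by simp)]
      simp
      ring
    · have : ∫ ξ in a..c, |ξ - c| = ∫ ξ in a..c, (c - ξ) :=
        intervalIntegral.integral_congr fun ξ hξ => by
          rw [uIcc_of_le hab] at hξ
          exact (abs_sub_comm _ _).trans (abs_of_nonneg (sub_nonneg.2 hξ.2))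
      rw [this, intervalIntegral.integral_sub (by simp) (by simp)]
      simp
      ring
  rw [hrep, ← hint]
  exact intervalIntegral.norm_integral_le_of_norm_le hab (Eventually.of_forall hbound)
    (Continuous.intervalIntegrable (by fun_prop) _ _)

/-- The squared distance of a continuous function to a step function on a partition. -/
theorem integral_sub_step_sq {h g : ℝ → ℝ} {y c : ℕ → ℝ} {N : ℕ}
    (hy : ∀ k < N, y k ≤ y (k + 1)) (hh : ContinuousOn h (Icc (y 0) (y N)))
    (hsub : ∀ k < N, Icc (y k) (y (k + 1)) ⊆ Icc (y 0) (y N))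
    (hg : ∀ k < N, ∀ ξ ∈ Ioo (y k) (y (k + 1)), g ξ = c k) :
    ∫ ξ in (y 0)..(y N), (h ξ - g ξ) ^ 2 =
      (∫ ξ in (y 0)..(y N), h ξ ^ 2) + ∑ k ∈ Finset.range N,
        (c k ^ 2 * (y (k + 1) - y k) - 2 * c k * ∫ ξ in (y k)..(y (k + 1)), h ξ) := by
  have hi : ∀ k < N, ContinuousOn h (Icc (y k) (y (k + 1))) := fun k hk => hh.mono (hsub k hk)
  have hEq : ∀ k < N, EqOn (fun ξ => (h ξ - c k) ^ 2) (fun ξ => (h ξ - g ξ) ^ 2)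
      (uIoo (y k) (y (k + 1))) := fun k hk ξ hξ => by
    rw [uIoo_of_le (hy k hk)] at hξ
    simp only [hg k hk ξ hξ]
  have hint : ∀ k < N, IntervalIntegrable (fun ξ => (h ξ - g ξ) ^ 2) volume (y k) (y (k + 1)) :=
    fun k hk => (ContinuousOn.intervalIntegrable_of_Icc (hy k hk)
      (((hi k hk).sub continuousOn_const).pow 2)).congr_uIoo (hEq k hk)
  have hint2 : ∀ k < N, IntervalIntegrable (fun ξ => h ξ ^ 2) volume (y k) (y (k + 1)) :=
    fun k hk => ContinuousOn.intervalIntegrable_of_Icc (hy k hk) ((hi k hk).pow 2)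
  rw [← intervalIntegral.sum_integral_adjacent_intervals hint,
    ← intervalIntegral.sum_integral_adjacent_intervals hint2, ← Finset.sum_add_distrib]
  refine Finset.sum_congr rfl fun k hk => ?_
  have hk := Finset.mem_range.1 hk
  have hih : IntervalIntegrable h volume (y k) (y (k + 1)) :=
    (hi k hk).intervalIntegrable_of_Icc (hy k hk)
  rw [← intervalIntegral.integral_congr_uIoo (hEq k hk)]
  have : ∀ ξ, (h ξ - c k) ^ 2 = h ξ ^ 2 + (c k ^ 2 - 2 * c k * h ξ) := fun ξ => by ring
  simp only [this]
  rw [intervalIntegral.integral_add (hint2 k hk)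
      (intervalIntegrable_const.sub (hih.const_mul _)),
    intervalIntegral.integral_sub intervalIntegrable_const (hih.const_mul _),
    intervalIntegral.integral_const_mul, intervalIntegral.integral_const, smul_eq_mul]
  ring

theorem sum_range_by_parts (f g : ℕ → ℝ) (n : ℕ) :
    ∑ k ∈ Finset.range (n + 1), f (k + 1) * (g (k + 1) - g k) =
      f (n + 1) * g (n + 1) - f 1 * g 0 -
        ∑ k ∈ Finset.range n, (f (k + 2) - f (k + 1)) * g (k + 1) := by
  induction n with
  | zero => simp; ring
  | succ n ih => rw [Finset.sum_range_succ, ih, Finset.sum_range_succ _ n]; ring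

theorem corner_sum_le {n : ℕ} {s v a p w l : ℕ → ℝ} {m L : ℝ}
    (hw : ∀ k < n, w (k + 1) * (s (k + 2) - s (k + 1)) = -(v (k + 2) - v (k + 1)))
    (hw0 : w 0 = 0) (hwN : w (n + 1) = 0) (ha0 : a 0 = 0) (haN : a (n + 1) = 0)
    (hl : ∀ k ≤ n, 0 < l k) (hl1 : ∑ k ∈ Finset.range (n + 1), l k = 1)
    (hv : ∀ k ≤ n, v (k + 1) * l k = (s (k + 2) - s k) / 2)
    (hv1 : v 1 = 0) (hvN : v (n + 1) = 0)
    (hm : ∀ k ≤ n + 1, |s (k + 1) - s k| ≤ m)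
    (hleft : ∀ k ≤ n, |p (k + 1) - p k - a k * l k| ≤ L * l k ^ 2 / 2)
    (hright : ∀ k ≤ n, |p (k + 1) - p k - a (k + 1) * l k| ≤ L * l k ^ 2 / 2) :
    -(∑ k ∈ Finset.range (n + 1), s (k + 1) *
        ((a (k + 1) + p (k + 1) * w (k + 1)) - (a k + p k * w k))) +
      (1 / 2) * ∑ k ∈ Finset.range (n + 1), s (k + 1) ^ 2 * (w (k + 1) - w k) ≤
    2 * (∑ k ∈ Finset.range (n + 1), v (k + 1) * (p (k + 1) - p k)) -
      (∑ k ∈ Finset.range (n + 1), v (k + 1) ^ 2 * l k) + (1 / 2) * m * L := by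
  have h1 := sum_range_by_parts s (fun k => a k + p k * w k) n
  have h2 := sum_range_by_parts (fun k => s k ^ 2) w n
  have h3 := sum_range_by_parts v p n
  have h4 := sum_range_by_parts v (fun k => s (k + 1) + s k) n
  simp only [ha0, haN, hw0, hwN, hv1, hvN, mul_zero, zero_mul, add_zero, sub_zero, zero_sub]
    at h1 h2 h3 h4
  have h5 : ∑ k ∈ Finset.range (n + 1), v (k + 1) ^ 2 * l k =
      (1 / 2) * ∑ k ∈ Finset.range (n + 1),
        v (k + 1) * (s (k + 1 + 1) + s (k + 1) - (s (k + 1) + s k)) := by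
    rw [Finset.mul_sum]
    refine Finset.sum_congr rfl fun k hk => ?_
    linear_combination v (k + 1) * hv k (Nat.lt_succ_iff.1 (Finset.mem_range.1 hk))
  have h6 : ∑ k ∈ Finset.range n, (s (k + 2) - s (k + 1)) * a (k + 1) =
      ∑ k ∈ Finset.range (n + 1),
        (1 / 2) * ((s (k + 2) - s (k + 1)) * a (k + 1) + (s (k + 1) - s k) * a k) := by
    rw [← Finset.mul_sum, Finset.sum_add_distrib, Finset.sum_range_succ,
      Finset.sum_range_succ' (fun k => (s (k + 1) - s k) * a k), haN, ha0]
    ring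
  have h7 : (∑ k ∈ Finset.range n,
        (s (k + 2) - s (k + 1)) * (a (k + 1) + p (k + 1) * w (k + 1))) -
      (1 / 2) * ∑ k ∈ Finset.range n, (s (k + 2) ^ 2 - s (k + 1) ^ 2) * w (k + 1) =
      (∑ k ∈ Finset.range n, (s (k + 2) - s (k + 1)) * a (k + 1)) -
      (∑ k ∈ Finset.range n, (v (k + 2) - v (k + 1)) * p (k + 1)) +
      (1 / 2) * ∑ k ∈ Finset.range n,
        (v (k + 2) - v (k + 1)) * (s (k + 1 + 1) + s (k + 1)) := by
    rw [Finset.mul_sum, Finset.mul_sum, ← Finset.sum_sub_distrib, ← Finset.sum_sub_distrib,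
      ← Finset.sum_add_distrib]
    refine Finset.sum_congr rfl fun k hk => ?_
    linear_combination (p (k + 1) - (s (k + 2) + s (k + 1)) / 2) * hw k (Finset.mem_range.1 hk)
  have h8 : ∑ k ∈ Finset.range (n + 1),
        (1 / 2) * ((s (k + 2) - s (k + 1)) * a (k + 1) + (s (k + 1) - s k) * a k) ≤
      (∑ k ∈ Finset.range (n + 1), v (k + 1) * (p (k + 1) - p k)) + (1 / 2) * m * L := by
    have hmL : (1 / 2) * m * L = ∑ k ∈ Finset.range (n + 1), (1 / 2) * m * L * l k := by
      rw [← Finset.mul_sum, hl1, mul_one]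
    rw [hmL, ← Finset.sum_add_distrib]
    refine Finset.sum_le_sum fun k hk => ?_
    have hk : k ≤ n := Nat.lt_succ_iff.1 (Finset.mem_range.1 hk)
    have hbound : ∀ {D e : ℝ}, |D| ≤ m → |e| ≤ L * l k ^ 2 / 2 →
        -(D * e) ≤ m * (L * l k ^ 2 / 2) := fun {D e} hD he =>
      (neg_le_abs _).trans (abs_mul D e ▸
        mul_le_mul hD he (abs_nonneg _) ((abs_nonneg _).trans hD))
    have e1 := hbound (hm (k + 1) (by omega)) (hright k hk)
    have e2 := hbound (hm k (by omega)) (hleft k hk)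
    refine le_of_mul_le_mul_right ?_ (hl k hk)
    have e3 := hv k hk
    have e4 : v (k + 1) * (p (k + 1) - p k) * l k =
        (s (k + 2) - s k) / 2 * (p (k + 1) - p k) := by rw [← e3]; ring
    rw [add_mul _ _ (l k), e4]
    linarith
  simp only [add_assoc, Nat.reduceAdd] at h1 h2 h3 h4 h5 h7 ⊢
  linarith

theorem CrystSol.corner_le {I : Set ℝ} (S : CrystSol I) {t : ℝ} (ht : t ∈ I) {j k : ℕ}
    (hjk : j ≤ k) (hk : k ≤ S.N) : S.x j t ≤ S.x k t := by
  induction k, hjk using Nat.le_induction with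
  | base => exact le_rfl
  | succ k _ ih => exact (ih (by omega)).trans (S.hmono t ht k hk).le

theorem CrystSol.corner_mem {I : Set ℝ} (S : CrystSol I) {t : ℝ} (ht : t ∈ I) {k : ℕ}
    (hk : k ≤ S.N) : S.x k t ∈ Icc (0 : ℝ) 1 :=
  ⟨S.hx0 t ht ▸ S.corner_le ht (Nat.zero_le k) hk, S.hxN t ht ▸ S.corner_le ht hk le_rfl⟩

theorem CrystSol.exists_corner_deriv {I : Set ℝ} (S : CrystSol I) {t : ℝ} (ht : t ∈ I) :
    ∃ w : ℕ → ℝ, (∀ k ≤ S.N, HasDerivWithinAt (S.x k) (w k) I t) ∧ w 0 = 0 ∧ w S.N = 0 ∧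
      ∀ k, k + 2 ≤ S.N →
        w (k + 1) * (S.s (k + 2) - S.s (k + 1)) = -(S.v (k + 2) t - S.v (k + 1) t) := by
  refine ⟨fun k => if k = 0 ∨ k = S.N then 0 else
    -((S.v (k + 1) t - S.v k t) / (S.s (k + 1) - S.s k)), fun k hk => ?_, by simp, by simp,
    fun k hk => ?_⟩
  · rcases eq_or_ne k 0 with rfl | h0
    · simpa using (hasDerivWithinAt_const t I (0 : ℝ)).congr (fun τ hτ => S.hx0 τ hτ)
        (S.hx0 t ht)
    rcases eq_or_ne k S.N with rfl | hN
    · simpa using (hasDerivWithinAt_const t I (1 : ℝ)).congr (fun τ hτ => S.hxN τ hτ)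
        (S.hxN t ht)
    simpa only [h0, hN, or_self, if_false] using S.hcorner t ht k (by omega) (by omega)
  · have hne : S.s (k + 2) - S.s (k + 1) ≠ 0 :=
      sub_ne_zero.2 (S.hs (k + 1) (by omega) hk).symm
    have hk' : ¬(k + 1 = 0 ∨ k + 1 = S.N) := by omega
    simp only [if_neg hk', neg_mul, div_mul_cancel₀ _ hne]

theorem ContinuousOn.slice_left {f : ℝ → ℝ → ℝ} {A B : Set ℝ}
    (hf : ContinuousOn (fun q : ℝ × ℝ => f q.1 q.2) (A ×ˢ B)) {t : ℝ} (ht : t ∈ B) :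
    ContinuousOn (fun ξ => f ξ t) A :=
  hf.comp (Continuous.prodMk_left t).continuousOn fun _ hξ => ⟨hξ, ht⟩

theorem C3Sol.integral_ux {T : ℝ} (H : C3Sol T) {t a b : ℝ} (ht : t ∈ Icc (0 : ℝ) T)
    (hab : a ≤ b) (hsub : Icc a b ⊆ Icc (0 : ℝ) 1) :
    ∫ ξ in a..b, H.ux ξ t = H.u b t - H.u a t :=
  intervalIntegral.integral_eq_sub_of_hasDerivAt_of_le hab
    (fun ξ hξ => ((H.hux t ht ξ (hsub hξ)).mono hsub).continuousWithinAt)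
    (fun ξ hξ => ((H.hux t ht ξ (hsub (Ioo_subset_Icc_self hξ))).mono hsub).hasDerivAt
      (Icc_mem_nhds hξ.1 hξ.2))
    ((H.hcont_ux.slice_left ht |>.mono hsub).intervalIntegrable_of_Icc hab)

theorem C3Sol.integral_uxx {T : ℝ} (H : C3Sol T) {t a b : ℝ} (ht : t ∈ Icc (0 : ℝ) T)
    (hab : a ≤ b) (hsub : Icc a b ⊆ Icc (0 : ℝ) 1) :
    ∫ ξ in a..b, H.uxx ξ t = H.ux b t - H.ux a t :=
  intervalIntegral.integral_eq_sub_of_hasDerivAt_of_le hab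
    (fun ξ hξ => ((H.huxx t ht ξ (hsub hξ)).mono hsub).continuousWithinAt)
    (fun ξ hξ => ((H.huxx t ht ξ (hsub (Ioo_subset_Icc_self hξ))).mono hsub).hasDerivAt
      (Icc_mem_nhds hξ.1 hξ.2))
    ((H.hcont_uxx.slice_left ht |>.mono hsub).intervalIntegrable_of_Icc hab)

theorem C3Sol.integral_uxt {T : ℝ} (hT : 0 < T) (H : C3Sol T) {t b : ℝ}
    (ht : t ∈ Icc (0 : ℝ) T) (hb : b ∈ Icc (0 : ℝ) 1) :
    ∫ ξ in (0 : ℝ)..b, H.uxt ξ t = H.ut b t - H.ut 0 t := by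
  have hsub : Icc (0 : ℝ) b ⊆ Icc 0 1 := Icc_subset_Icc_right hb.2
  have hrect : Icc (0 : ℝ) b ×ˢ Icc 0 T ⊆ Icc (0 : ℝ) 1 ×ˢ Icc 0 T :=
    prod_mono hsub subset_rfl
  have h1 := hasDerivWithinAt_intervalIntegral_of_continuousOn hb.1 ht
    (H.hcont_ux.mono hrect) (H.hcont_uxt.mono hrect) fun ξ hξ => H.huxt ξ (hsub hξ)
  have h2 := (H.hut b hb t ht).fun_sub (H.hut 0 (by simp) t ht)
  exact (uniqueDiffOn_Icc hT t ht).eq_deriv _ h1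
    (h2.congr (fun τ hτ => H.integral_ux hτ hb.1 hsub) (H.integral_ux ht hb.1 hsub))

theorem C3Sol.hasDerivAt_ut {T : ℝ} (hT : 0 < T) (H : C3Sol T) {t ξ : ℝ}
    (ht : t ∈ Icc (0 : ℝ) T) (hξ : ξ ∈ Ioo (0 : ℝ) 1) :
    HasDerivAt (fun ζ => H.ut ζ t) (H.uxt ξ t) ξ := by
  have hc := H.hcont_uxt.slice_left ht
  have hnhds : Icc (0 : ℝ) 1 ∈ 𝓝 ξ := Icc_mem_nhds hξ.1 hξ.2
  have h := intervalIntegral.integral_hasDerivAt_right (a := 0) (b := ξ)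
    ((hc.mono (Icc_subset_Icc_right hξ.2.le)).intervalIntegrable_of_Icc hξ.1.le)
    ((hc.mono Ioo_subset_Icc_self).stronglyMeasurableAtFilter isOpen_Ioo ξ hξ)
    (hc.continuousAt hnhds)
  refine (h.const_add (H.ut 0 t)).congr_of_eventuallyEq ?_
  filter_upwards [hnhds] with ζ hζ
  rw [H.integral_uxt hT ht hζ]
  ring

theorem C3Sol.ut_eq_zero {T : ℝ} (hT : 0 < T) (H : C3Sol T) {t ξ : ℝ}
    (ht : t ∈ Icc (0 : ℝ) T) (hξ : ξ ∈ Icc (0 : ℝ) 1)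
    (h0 : ∀ τ ∈ Icc (0 : ℝ) T, H.u ξ τ = 0) : H.ut ξ t = 0 :=
  (uniqueDiffOn_Icc hT t ht).eq_deriv _ (H.hut ξ hξ t ht)
    ((hasDerivWithinAt_const t _ (0 : ℝ)).congr h0 (h0 t ht))

theorem C3Sol.integral_ux_mul_uxt {T : ℝ} (hT : 0 < T) (H : C3Sol T) {t : ℝ}
    (ht : t ∈ Icc (0 : ℝ) T) (hpde : ∀ ξ ∈ Icc (0 : ℝ) 1, H.ut ξ t = H.uxx ξ t)
    (h0 : H.ut 0 t = 0) (h1 : H.ut 1 t = 0) :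
    ∫ ξ in (0 : ℝ)..1, H.ux ξ t * H.uxt ξ t = -∫ ξ in (0 : ℝ)..1, H.ut ξ t ^ 2 := by
  have huIcc : uIcc (0 : ℝ) 1 = Icc 0 1 := uIcc_of_le zero_le_one
  have hc : ∀ {f : ℝ → ℝ → ℝ},
      ContinuousOn (fun q : ℝ × ℝ => f q.1 q.2) (Icc 0 1 ×ˢ Icc 0 T) →
      ContinuousOn (fun ξ => f ξ t) (uIcc (0 : ℝ) 1) := fun hf => huIcc ▸ hf.slice_left ht
  rw [intervalIntegral.integral_mul_deriv_eq_deriv_mul_of_hasDerivAt (u := fun ξ => H.ux ξ t)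
    (v := fun ξ => H.ut ξ t) (u' := fun ξ => H.uxx ξ t)
    (hc H.hcont_ux) (hc H.hcont_ut)
    (fun ξ hξ => (H.huxx t ht ξ (by simpa using Ioo_subset_Icc_self hξ)).hasDerivAt
      (by simp at hξ; exact Icc_mem_nhds hξ.1 hξ.2))
    (fun ξ hξ => H.hasDerivAt_ut hT ht (by simpa using hξ))
    (hc H.hcont_uxx).intervalIntegrable (hc H.hcont_uxt).intervalIntegrable, h0, h1]
  rw [mul_zero, mul_zero, sub_zero, zero_sub]
  congr 1
  refine intervalIntegral.integral_congr fun ξ hξ => ?_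
  simp only [← hpde ξ (huIcc ▸ hξ), pow_two]

theorem C3Sol.hasDerivWithinAt_integral_ux_sq {T : ℝ} (H : C3Sol T) {t : ℝ}
    (ht : t ∈ Icc (0 : ℝ) T) :
    HasDerivWithinAt (fun σ => ∫ ξ in (0 : ℝ)..1, H.ux ξ σ ^ 2)
      (2 * ∫ ξ in (0 : ℝ)..1, H.ux ξ t * H.uxt ξ t) (Icc 0 T) t := by
  rw [← intervalIntegral.integral_const_mul]
  refine hasDerivWithinAt_intervalIntegral_of_continuousOn (f := fun ξ σ => H.ux ξ σ ^ 2)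
    (f' := fun ξ σ => 2 * (H.ux ξ σ * H.uxt ξ σ)) zero_le_one ht
    (H.hcont_ux.pow 2) (continuousOn_const.mul (H.hcont_ux.mul H.hcont_uxt))
    fun ξ hξ τ hτ => ?_
  exact ((H.huxt ξ hξ τ hτ).fun_pow 2).congr_deriv (by simp; ring)

theorem C3Sol.abs_uxxx_le_iSup {T : ℝ} (H : C3Sol T) {t ξ : ℝ} (ht : t ∈ Icc (0 : ℝ) T)
    (hξ : ξ ∈ Icc (0 : ℝ) 1) :
    |H.uxxx ξ t| ≤ ⨆ ζ : Icc (0 : ℝ) 1, |H.uxxx (ζ : ℝ) t| := by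
  obtain ⟨C, hC⟩ := isCompact_Icc.exists_bound_of_continuousOn (H.hcont_uxxx.slice_left ht)
  exact le_ciSup (f := fun ζ : Icc (0 : ℝ) 1 => |H.uxxx (ζ : ℝ) t|)
    ⟨C, by rintro _ ⟨ζ, rfl⟩; exact hC ζ ζ.2⟩ ⟨ξ, hξ⟩

/-- Basic error estimate for the crystalline approximation of the heat equation with
homogeneous Dirichlet boundary conditions:
`(d/dt)(1/2)∫₀¹ |u_x - u_x^m|² ≤ -∫₀¹ |u_t - u_t^m|² + (1/2) m ‖u_xxx(·,t)‖_∞`. -/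
theorem heat_error_derivative_estimate (T m : ℝ) (hT : 0 < T) (H : C3Sol T)
    (hpde : ∀ ξ ∈ Set.Icc (0:ℝ) 1, ∀ t ∈ Set.Icc (0:ℝ) T, H.ut ξ t = H.uxx ξ t)
    (hbc : ∀ t ∈ Set.Icc (0:ℝ) T, H.u 0 t = 0 ∧ H.u 1 t = 0)
    (I : Set ℝ) (hI : I ⊆ Set.Icc 0 T)
    (S : CrystSol I) (uxm utm : ℝ → ℝ → ℝ)
    (huxm : SlopeLink S uxm) (hutm : VelLink S utm)
    (hs0 : S.s 0 = S.s 2) (hsN : S.s (S.N + 1) = S.s (S.N - 1))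
    (hbdry : ∀ t ∈ I, S.v 1 t = 0 ∧ S.v S.N t = 0)
    (hevol : ∀ t ∈ I, ∀ i, 2 ≤ i → i ≤ S.N - 1 →
      S.v i t = (S.s (i + 1) - S.s (i - 1)) / (2 * S.len i t))
    (hm : ∀ i, 1 ≤ i → i ≤ S.N + 1 → |S.s i - S.s (i - 1)| ≤ m) :
    ∀ t ∈ I, ∃ d : ℝ,
      HasDerivWithinAt
        (fun σ => (1 / 2) * ∫ ξ in (0:ℝ)..1, (H.ux ξ σ - uxm ξ σ) ^ 2) d I t ∧
      d ≤ -(∫ ξ in (0:ℝ)..1, (H.ut ξ t - utm ξ t) ^ 2)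
          + (1 / 2) * m * ⨆ ξ : Set.Icc (0:ℝ) 1, |H.uxxx (ξ : ℝ) t| := by
  intro t ht
  obtain ⟨n, hn⟩ : ∃ n, S.N = n + 1 := ⟨S.N - 1, by have := S.hN; omega⟩
  have htT : t ∈ Icc (0 : ℝ) T := hI ht
  have hmono : ∀ σ ∈ I, ∀ k < n + 1, S.x k σ ≤ S.x (k + 1) σ := fun σ hσ k hk =>
    (S.hmono σ hσ k (by omega)).le
  have hface : ∀ σ ∈ I, ∀ k < n + 1, Icc (S.x k σ) (S.x (k + 1) σ) ⊆ Icc 0 1 :=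
    fun σ hσ k hk => Icc_subset_Icc (S.corner_mem hσ (by omega)).1
      (S.corner_mem hσ (by omega)).2
  have hstep : ∀ σ ∈ I, ∀ {h g : ℝ → ℝ} {c : ℕ → ℝ}, ContinuousOn h (Icc 0 1) →
      (∀ k < n + 1, ∀ ξ ∈ Ioo (S.x k σ) (S.x (k + 1) σ), g ξ = c k) →
      ∫ ξ in (0 : ℝ)..1, (h ξ - g ξ) ^ 2 =
        (∫ ξ in (0 : ℝ)..1, h ξ ^ 2) + ∑ k ∈ Finset.range (n + 1),
          (c k ^ 2 * (S.x (k + 1) σ - S.x k σ) -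
            2 * c k * ∫ ξ in (S.x k σ)..(S.x (k + 1) σ), h ξ) := by
    intro σ hσ h g c hh hg
    have h0 : S.x 0 σ = 0 := S.hx0 σ hσ
    have h1 : S.x (n + 1) σ = 1 := hn ▸ S.hxN σ hσ
    have := integral_sub_step_sq (y := fun k => S.x k σ) (N := n + 1) (hmono σ hσ)
      (by simpa only [h0, h1] using hh) (by simpa only [h0, h1] using hface σ hσ) hg
    simpa only [h0, h1] using this
  have henergy : ∀ σ ∈ I, (1 / 2) * ∫ ξ in (0 : ℝ)..1, (H.ux ξ σ - uxm ξ σ) ^ 2 =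
      (1 / 2) * (∫ ξ in (0 : ℝ)..1, H.ux ξ σ ^ 2) +
        (-(∑ k ∈ Finset.range (n + 1),
            S.s (k + 1) * (H.u (S.x (k + 1) σ) σ - H.u (S.x k σ) σ)) +
          (1 / 2) * ∑ k ∈ Finset.range (n + 1),
            S.s (k + 1) ^ 2 * (S.x (k + 1) σ - S.x k σ)) := by
    intro σ hσ
    rw [hstep σ hσ (H.hcont_ux.slice_left (hI hσ)) (c := fun k => S.s (k + 1))
      fun k hk => huxm σ hσ (k + 1) (by omega) (by omega), mul_add, Finset.mul_sum,
      Finset.mul_sum, ← Finset.sum_neg_distrib, ← Finset.sum_add_distrib]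
    congr 1
    refine Finset.sum_congr rfl fun k hk => ?_
    have hk := Finset.mem_range.1 hk
    rw [H.integral_ux (hI hσ) (hmono σ hσ k hk) (hface σ hσ k hk)]
    ring
  obtain ⟨w, hw, hw0, hwN, hwv⟩ := S.exists_corner_deriv ht
  rw [hn] at hwN
  have hcorner : ∀ k ≤ n + 1, HasDerivWithinAt (fun σ => H.u (S.x k σ) σ)
      (H.ut (S.x k t) t + H.ux (S.x k t) t * w k) I t := fun k hk =>
    hasDerivWithinAt_comp_moving_point hI ht H.hux H.hcont_ux
      (H.hut _ (S.corner_mem ht (by omega)) t htT) (hw k (by omega))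
      fun τ hτ => S.corner_mem hτ (by omega)
  have hut0 : H.ut 0 t = 0 := H.ut_eq_zero hT htT (by simp) fun τ hτ => (hbc τ hτ).1
  have hut1 : H.ut 1 t = 0 := H.ut_eq_zero hT htT (by simp) fun τ hτ => (hbc τ hτ).2
  have hderiv := (((H.hasDerivWithinAt_integral_ux_sq htT).mono hI).const_mul (1 / 2)).fun_add
    ((HasDerivWithinAt.fun_sum fun k (hk : k ∈ Finset.range (n + 1)) =>
      ((hcorner (k + 1) (Finset.mem_range.1 hk)).fun_sub
        (hcorner k (Finset.mem_range.1 hk).le)).const_mul (S.s (k + 1))).fun_neg.fun_add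
    ((HasDerivWithinAt.fun_sum fun k (hk : k ∈ Finset.range (n + 1)) =>
      ((hw (k + 1) (hn ▸ Finset.mem_range.1 hk)).fun_sub
        (hw k (hn ▸ (Finset.mem_range.1 hk).le))).const_mul
          (S.s (k + 1) ^ 2)).const_mul (1 / 2)))
  refine ⟨_, hderiv.congr henergy (henergy t ht), ?_⟩
  have hpdet : ∀ ξ ∈ Icc (0 : ℝ) 1, H.ut ξ t = H.uxx ξ t := fun ξ hξ => hpde ξ hξ t htT
  have hfaceut : ∀ k < n + 1, ∫ ξ in (S.x k t)..(S.x (k + 1) t), H.ut ξ t =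
      H.ux (S.x (k + 1) t) t - H.ux (S.x k t) t := fun k hk => by
    rw [← H.integral_uxx htT (hmono t ht k hk) (hface t ht k hk)]
    refine intervalIntegral.integral_congr fun ξ hξ => hpdet ξ (hface t ht k hk ?_)
    rwa [uIcc_of_le (hmono t ht k hk)] at hξ
  have htaylor : ∀ k ≤ n, ∀ c, c = S.x k t ∨ c = S.x (k + 1) t →
      |H.ux (S.x (k + 1) t) t - H.ux (S.x k t) t - H.ut c t * (S.x (k + 1) t - S.x k t)| ≤
        (⨆ ξ : Icc (0 : ℝ) 1, |H.uxxx (ξ : ℝ) t|) * (S.x (k + 1) t - S.x k t) ^ 2 / 2 := by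
    intro k hk c hc
    have hle := hmono t ht k (by omega)
    have hsub := hface t ht k (by omega)
    rw [hpdet c (hsub (by rcases hc with rfl | rfl <;> simp [hle]))]
    exact abs_sub_sub_mul_le hle (fun ξ hξ => (H.huxx t htT ξ (hsub hξ)).mono hsub)
      (fun ξ hξ => (H.huxxx t htT ξ (hsub hξ)).mono hsub)
      (fun ξ hξ => H.abs_uxxx_le_iSup htT (hsub hξ)) hc
  have hx0 := S.hx0 t ht
  have hxN : S.x (n + 1) t = 1 := hn ▸ S.hxN t ht
  have hvN : S.v (n + 1) t = 0 := hn ▸ (hbdry t ht).2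
  have hpos : ∀ k ≤ n, 0 < S.x (k + 1) t - S.x k t := fun k hk =>
    sub_pos.2 (S.hmono t ht k (by omega))
  have hv : ∀ k ≤ n, S.v (k + 1) t * (S.x (k + 1) t - S.x k t) =
      (S.s (k + 2) - S.s k) / 2 := by
    intro k hk
    rcases Nat.eq_zero_or_pos k with rfl | hk0
    · simp [(hbdry t ht).1, hs0]
    rcases hk.eq_or_lt with rfl | hkn
    · rw [hn] at hsN
      simp only [Nat.add_sub_cancel] at hsN
      simp [hvN, hsN]
    · have hlen : S.len (k + 1) t = S.x (k + 1) t - S.x k t := rfl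
      rw [hevol t ht (k + 1) (by omega) (by omega), hlen, Nat.add_sub_cancel]
      have := (hpos k hk).ne'
      field_simp
  have hmain := corner_sum_le (n := n) (s := S.s) (v := fun k => S.v k t)
    (a := fun k => H.ut (S.x k t) t) (p := fun k => H.ux (S.x k t) t) (w := w)
    (l := fun k => S.x (k + 1) t - S.x k t) (fun k hk => hwv k (by omega)) hw0 hwN
    (by rw [hx0, hut0]) (by rw [hxN, hut1]) hpos
    (by rw [Finset.sum_range_sub (fun k => S.x k t), hxN, hx0, sub_zero]) hv
    (hbdry t ht).1 hvN (fun k hk => hm (k + 1) (by omega) (by omega))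
    (fun k hk => htaylor k hk _ (Or.inl rfl)) (fun k hk => htaylor k hk _ (Or.inr rfl))
  have hrhs : ∫ ξ in (0 : ℝ)..1, (H.ut ξ t - utm ξ t) ^ 2 =
      (∫ ξ in (0 : ℝ)..1, H.ut ξ t ^ 2) +
        ((∑ k ∈ Finset.range (n + 1), S.v (k + 1) t ^ 2 * (S.x (k + 1) t - S.x k t)) -
          2 * ∑ k ∈ Finset.range (n + 1),
            S.v (k + 1) t * (H.ux (S.x (k + 1) t) t - H.ux (S.x k t) t)) := by
    rw [hstep t ht (H.hcont_ut.slice_left htT) (c := fun k => S.v (k + 1) t)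
      fun k hk => hutm t ht (k + 1) (by omega) (by omega), Finset.mul_sum,
      ← Finset.sum_sub_distrib]
    congr 1
    refine Finset.sum_congr rfl fun k hk => ?_
    rw [hfaceut k (Finset.mem_range.1 hk)]
    ring
  rw [hrhs, H.integral_ux_mul_uxt hT htT hpdet hut0 hut1]
  linarith
end

section
/- Let u be a C³ solution of the heat equation u_t = u_xx on [0,1]×[0,T] with u(0,t) = u(1,t) = 0. Let u^m : [0,1]×[0,T] → ℝ be continuous with t ↦ ∫₀¹ |u_x(x,t) − u_x^m(x,t)|² dx continuous on [0,T], and suppose there is a partition 0 = τ_0 < τ_1 < … < τ_J = T such that on each open subinterval (τ_{j−1}, τ_j) the function u^m is a crystalline discrete solution for W(p) = p²/2 with auxiliary slopes s_0 = s_2 and s_{N+1} = s_{N−1}, boundary conditions v_1 = v_N = 0, interior evolution v_i = (s_{i+1} − s_{i−1})/(2 l_i) for 2 ≤ i ≤ N−1, and max_{1 ≤ i ≤ N+1} |s_i − s_{i−1}| ≤ m. Assume ‖u_x^m(·,0) − u_x(·,0)‖_{L∞([0,1])} ≤ m. Then for every t ∈ [0,T], (1/2)∫₀¹ |u_x(x,t)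 − u_x^m(x,t)|² dx ≤ (1/2) m² + (1/2) m ∫₀ᵗ ‖u_{xxx}(·,τ)‖_{L∞([0,1])} dτ. -/
open Set MeasureTheory

/-- Summation by parts. -/
theorem sum_mul_sub_succ (f g : ℕ → ℝ) (M : ℕ) :
    ∑ k ∈ Finset.range (M + 1), f (k + 1) * (g (k + 1) - g k) =
      f (M + 1) * g (M + 1) - f 1 * g 0 -
        ∑ i ∈ Finset.range M, (f (i + 2) - f (i + 1)) * g (i + 1) := by
  induction M with
  | zero => simp; ring
  | succ n ih => rw [Finset.sum_range_succ, ih, Finset.sum_range_succ _ n]; ring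

/-- The algebraic core of the energy estimate. The `k`-th face has length `l k`, velocity `V k`
and slope `s (k + 1)`; `P`, `A`, `w` are the values of `u_x`, `u_xx` and the speed at the corners,
`Q k` is the integral of `u_xx ^ 2` over the face and `B k` a value of `u_xx` on it. -/
theorem crystal_rate_le {M : ℕ} (hM : 1 ≤ M) {s V w P A l B Q : ℕ → ℝ} {m K : ℝ}
    (hw0 : w 0 = 0) (hwN : w (M + 1) = 0)
    (hw : ∀ i < M, (s (i + 2) - s (i + 1)) * w (i + 1) = -(V (i + 1) - V i))
    (hV0 : V 0 = 0) (hVM : V M = 0)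
    (hVl : ∀ k ≤ M, V k * l k = (s (k + 2) - s k) / 2)
    (hA0 : A 0 = 0) (hAN : A (M + 1) = 0)
    (hB : ∀ k ≤ M, |A (k + 1) - B k| + |A k - B k| ≤ K * l k)
    (hB0 : B 0 = 0) (hBM : B M = 0)
    (hVB : ∀ k ≤ M, V k * (P (k + 1) - P k) = (s (k + 2) - s k) / 2 * B k)
    (hQ : ∀ k ≤ M, 2 * V k * (P (k + 1) - P k) - V k ^ 2 * l k ≤ Q k)
    (hl : ∑ k ∈ Finset.range (M + 1), l k = 1)
    (hs : ∀ i < M, |s (i + 2) - s (i + 1)| ≤ m) :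
    -∑ k ∈ Finset.range (M + 1), Q k
      - ∑ k ∈ Finset.range (M + 1), s (k + 1) * (A (k + 1) - A k)
      - ∑ k ∈ Finset.range (M + 1), s (k + 1) * (P (k + 1) * w (k + 1) - P k * w k)
      + (∑ k ∈ Finset.range (M + 1), s (k + 1) ^ 2 * (w (k + 1) - w k)) / 2 ≤ m * K / 2 := by
  have hm : 0 ≤ m := (abs_nonneg _).trans (hs 0 hM)
  have e1 := sum_mul_sub_succ s A M
  have e2 := sum_mul_sub_succ s (fun k => P k * w k) M
  have e3 := sum_mul_sub_succ (fun k => s k ^ 2) w M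
  have e4 := sum_mul_sub_succ (fun k => V (k - 1)) P M
  have e5 := sum_mul_sub_succ (fun k => V (k - 1)) (fun k => s (k + 1) + s k) M
  simp only [hA0, hAN, hw0, hwN, hV0, hVM, Nat.add_one_sub_one, mul_zero,
    zero_mul, sub_zero, zero_sub, Nat.sub_self] at e1 e2 e3 e4 e5
  have f2 : ∑ i ∈ Finset.range M, (s (i + 2) - s (i + 1)) * (P (i + 1) * w (i + 1)) =
      -∑ i ∈ Finset.range M, (V (i + 1) - V i) * P (i + 1) := by
    rw [← Finset.sum_neg_distrib]
    refine Finset.sum_congr rfl fun i hi => ?_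
    linear_combination P (i + 1) * hw i (Finset.mem_range.1 hi)
  have f3 : ∑ i ∈ Finset.range M, (s (i + 2) ^ 2 - s (i + 1) ^ 2) * w (i + 1) =
      -∑ i ∈ Finset.range M, (V (i + 1) - V i) * (s (i + 1 + 1) + s (i + 1)) := by
    rw [← Finset.sum_neg_distrib]
    refine Finset.sum_congr rfl fun i hi => ?_
    linear_combination (s (i + 2) + s (i + 1)) * hw i (Finset.mem_range.1 hi)
  have f5 : ∑ k ∈ Finset.range (M + 1), V k * (s (k + 1 + 1) + s (k + 1) - (s (k + 1) + s k)) =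
      2 * ∑ k ∈ Finset.range (M + 1), V k ^ 2 * l k := by
    rw [Finset.mul_sum]
    refine Finset.sum_congr rfl fun k hk => ?_
    linear_combination (-2 * V k) * hVl k (Finset.mem_range_succ_iff.1 hk)
  have fQ : 2 * ∑ k ∈ Finset.range (M + 1), V k * (P (k + 1) - P k)
      - ∑ k ∈ Finset.range (M + 1), V k ^ 2 * l k ≤ ∑ k ∈ Finset.range (M + 1), Q k := by
    rw [Finset.mul_sum, ← Finset.sum_sub_distrib]
    refine Finset.sum_le_sum fun k hk => ?_
    linarith [hQ k (Finset.mem_range_succ_iff.1 hk)]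
  have fB : ∑ k ∈ Finset.range (M + 1), V k * (P (k + 1) - P k) =
      (∑ i ∈ Finset.range M, (s (i + 2) - s (i + 1)) * (B i + B (i + 1))) / 2 := by
    have h1 : ∑ k ∈ Finset.range (M + 1), V k * (P (k + 1) - P k) =
        (∑ k ∈ Finset.range (M + 1), (s (k + 2) - s (k + 1)) * B k +
          ∑ k ∈ Finset.range (M + 1), (s (k + 1) - s k) * B k) / 2 := by
      rw [← Finset.sum_add_distrib, Finset.sum_div]
      refine Finset.sum_congr rfl fun k hk => ?_
      linear_combination hVB k (Finset.mem_range_succ_iff.1 hk)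
    rw [h1, Finset.sum_range_succ, Finset.sum_range_succ', hB0, hBM]
    simp only [mul_zero, add_zero]
    rw [← Finset.sum_add_distrib]
    congr 1
    exact Finset.sum_congr rfl fun k hk => by ring
  have fA : ∑ i ∈ Finset.range M, (s (i + 2) - s (i + 1)) * A (i + 1) -
      (∑ i ∈ Finset.range M, (s (i + 2) - s (i + 1)) * (B i + B (i + 1))) / 2 ≤
      m / 2 * (∑ i ∈ Finset.range M, |A (i + 1) - B i| +
        ∑ i ∈ Finset.range M, |A (i + 1) - B (i + 1)|) := by
    rw [← Finset.sum_add_distrib, Finset.sum_div, ← Finset.sum_sub_distrib, Finset.mul_sum]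
    refine Finset.sum_le_sum fun i hi => ?_
    have h1 : (s (i + 2) - s (i + 1)) * ((A (i + 1) - B i) + (A (i + 1) - B (i + 1))) ≤
        m * (|A (i + 1) - B i| + |A (i + 1) - B (i + 1)|) := by
      refine (le_abs_self _).trans ?_
      rw [abs_mul]
      exact mul_le_mul (hs i (Finset.mem_range.1 hi)) (abs_add_le _ _) (abs_nonneg _) hm
    linarith
  have fK : ∑ i ∈ Finset.range M, |A (i + 1) - B i| +
      ∑ i ∈ Finset.range M, |A (i + 1) - B (i + 1)| ≤ K := by
    have h1 : ∑ k ∈ Finset.range (M + 1), (|A (k + 1) - B k| + |A k - B k|) ≤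
        ∑ k ∈ Finset.range (M + 1), K * l k :=
      Finset.sum_le_sum fun k hk => hB k (Finset.mem_range_succ_iff.1 hk)
    rw [← Finset.mul_sum, hl, Finset.sum_add_distrib, Finset.sum_range_succ,
      Finset.sum_range_succ' (fun k => |A k - B k|)] at h1
    linarith [abs_nonneg (A (M + 1) - B M), abs_nonneg (A 0 - B 0)]
  have := mul_le_mul_of_nonneg_left fK (show 0 ≤ m / 2 by positivity)
  linarith

theorem continuousOn_left_of_prod {f : ℝ → ℝ → ℝ} {A B : Set ℝ} {t : ℝ}
    (hf : ContinuousOn (fun q : ℝ × ℝ => f q.1 q.2) (A ×ˢ B)) (ht : t ∈ B) :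
    ContinuousOn (fun ξ => f ξ t) A :=
  hf.comp (f := fun ξ => (ξ, t)) (by fun_prop) fun _ hξ => ⟨hξ, ht⟩

/-- Differentiation under the integral sign over a compact interval. -/
theorem hasDerivAt_intervalIntegral_of_continuousOn {f f' : ℝ → ℝ → ℝ} {a b c d t : ℝ}
    (hab : a ≤ b) (ht : t ∈ Ioo c d)
    (hf : ContinuousOn (fun q : ℝ × ℝ => f q.1 q.2) (Icc a b ×ˢ Icc c d))
    (hf' : ContinuousOn (fun q : ℝ × ℝ => f' q.1 q.2) (Icc a b ×ˢ Icc c d))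
    (hd : ∀ ξ ∈ Icc a b, ∀ τ ∈ Icc c d,
      HasDerivWithinAt (fun r => f ξ r) (f' ξ τ) (Icc c d) τ) :
    HasDerivAt (fun τ => ∫ ξ in a..b, f ξ τ) (∫ ξ in a..b, f' ξ t) t := by
  obtain ⟨C, hC⟩ := (isCompact_Icc.prod isCompact_Icc).exists_bound_of_continuousOn hf'
  have hI : uIoc a b ⊆ Icc a b := by rw [uIoc_of_le hab]; exact Ioc_subset_Icc_self
  have hm {g : ℝ → ℝ → ℝ} (hg : ContinuousOn (fun q : ℝ × ℝ => g q.1 q.2) (Icc a b ×ˢ Icc c d))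
      {τ : ℝ} (hτ : τ ∈ Icc c d) :
      AEStronglyMeasurable (fun ξ => g ξ τ) (volume.restrict (uIoc a b)) :=
    ((continuousOn_left_of_prod hg hτ).mono hI).aestronglyMeasurable measurableSet_uIoc
  refine (intervalIntegral.hasDerivAt_integral_of_dominated_loc_of_deriv_le
    (F := fun τ ξ => f ξ τ) (F' := fun τ ξ => f' ξ τ) (bound := fun _ => C)
    (Ioo_mem_nhds ht.1 ht.2) ?_ ?_ (hm hf' (Ioo_subset_Icc_self ht)) ?_ (by simp) ?_).2
  · filter_upwards [Ioo_mem_nhds ht.1 ht.2] with τ hτ using hm hf (Ioo_subset_Icc_self hτ)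
  · refine ContinuousOn.intervalIntegrable ?_
    rw [uIcc_of_le hab]
    exact continuousOn_left_of_prod hf (Ioo_subset_Icc_self ht)
  · exact Filter.Eventually.of_forall fun ξ hξ τ hτ => hC (ξ, τ) ⟨hI hξ, Ioo_subset_Icc_self hτ⟩
  · exact Filter.Eventually.of_forall fun ξ hξ τ hτ =>
      (hd ξ (hI hξ) τ (Ioo_subset_Icc_self hτ)).hasDerivAt (Icc_mem_nhds hτ.1 hτ.2)

/-- Chain rule along a moving point for a function with continuous partial derivatives. -/
theorem hasDerivAt_comp_moving_point {f fx ft : ℝ → ℝ → ℝ} {a b c d t y' : ℝ} {y : ℝ → ℝ}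
    (ht : t ∈ Ioo c d) (hyt : y t ∈ Ioo a b) (hy : HasDerivAt y y' t)
    (hfx : ContinuousOn (fun q : ℝ × ℝ => fx q.1 q.2) (Icc a b ×ˢ Icc c d))
    (hft : ContinuousOn (fun q : ℝ × ℝ => ft q.1 q.2) (Icc a b ×ˢ Icc c d))
    (hdx : ∀ τ ∈ Icc c d, ∀ ξ ∈ Icc a b,
      HasDerivWithinAt (fun r => f r τ) (fx ξ τ) (Icc a b) ξ)
    (hdt : ∀ ξ ∈ Icc a b, ∀ τ ∈ Icc c d,
      HasDerivWithinAt (fun r => f ξ r) (ft ξ τ) (Icc c d) τ) :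
    HasDerivAt (fun τ => f (y τ) τ) (fx (y t) t * y' + ft (y t) t) t := by
  have hnhds : Icc a b ×ˢ Icc c d ∈ nhds (y t, t) :=
    prod_mem_nhds (Icc_mem_nhds hyt.1 hyt.2) (Icc_mem_nhds ht.1 ht.2)
  have hev : ∀ᶠ q : ℝ × ℝ in nhds (y t, t), q ∈ Ioo a b ×ˢ Ioo c d :=
    prod_mem_nhds (Ioo_mem_nhds hyt.1 hyt.2) (Ioo_mem_nhds ht.1 ht.2)
  have key := hasStrictFDerivAt_uncurry_coprod (𝕜 := ℝ) (u := (y t, t)) (f := f)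
    (f₁ := fun ξ τ => ContinuousLinearMap.toSpanSingleton ℝ (fx ξ τ))
    (f₂ := fun ξ τ => ContinuousLinearMap.toSpanSingleton ℝ (ft ξ τ))
    (hev.mono fun q hq => ((hdx q.2 (Ioo_subset_Icc_self hq.2) q.1
      (Ioo_subset_Icc_self hq.1)).hasDerivAt (Icc_mem_nhds hq.1.1 hq.1.2)).hasFDerivAt)
    (hev.mono fun q hq => ((hdt q.1 (Ioo_subset_Icc_self hq.1) q.2
      (Ioo_subset_Icc_self hq.2)).hasDerivAt (Icc_mem_nhds hq.2.1 hq.2.2)).hasFDerivAt)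
    ((ContinuousLinearMap.toSpanSingletonCLE (𝕜 := ℝ) (E := ℝ)).continuous.continuousAt.comp
      (hfx.continuousAt hnhds))
    ((ContinuousLinearMap.toSpanSingletonCLE (𝕜 := ℝ) (E := ℝ)).continuous.continuousAt.comp
      (hft.continuousAt hnhds))
  have h := HasFDerivAt.comp_hasDerivAt t (f := fun τ => (y τ, τ)) key.hasFDerivAt
    (hy.prodMk (hasDerivAt_id t))
  refine h.congr_deriv ?_
  simp [Function.HasUncurry.uncurry, mul_comm]

namespace C3Sol

variable {T : ℝ} (H : C3Sol T)

theorem integral_ux_s1 {t a b : ℝ} (ht : t ∈ Icc 0 T) (ha : 0 ≤ a) (hab : a ≤ b) (hb : b ≤ 1) :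
    ∫ ξ in a..b, H.ux ξ t = H.u b t - H.u a t := by
  have hs : Icc a b ⊆ Icc 0 1 := Icc_subset_Icc ha hb
  refine intervalIntegral.integral_eq_sub_of_hasDerivAt_of_le hab
    (fun ξ hξ => ((H.hux t ht ξ (hs hξ)).continuousWithinAt.mono hs)) (fun ξ hξ =>
      (H.hux t ht ξ (hs (Ioo_subset_Icc_self hξ))).hasDerivAt
        (Icc_mem_nhds (ha.trans_lt hξ.1) (hξ.2.trans_le hb)))
    (((continuousOn_left_of_prod H.hcont_ux ht).mono ?_).intervalIntegrable)
  rwa [uIcc_of_le hab]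

theorem integral_uxt_s1 {t x : ℝ} (ht : t ∈ Ioo 0 T) (hx : x ∈ Icc (0 : ℝ) 1)
    (hpde : ∀ ξ ∈ Icc (0 : ℝ) 1, ∀ t ∈ Icc (0 : ℝ) T, H.ut ξ t = H.uxx ξ t) :
    ∫ ξ in (0 : ℝ)..x, H.uxt ξ t = H.uxx x t - H.uxx 0 t := by
  have h0 : (0 : ℝ) ∈ Icc (0 : ℝ) 1 := by simp
  have hs : Icc 0 x ×ˢ Icc 0 T ⊆ Icc 0 1 ×ˢ Icc 0 T :=
    prod_mono (Icc_subset_Icc_right hx.2) le_rfl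
  have h1 := hasDerivAt_intervalIntegral_of_continuousOn hx.1 ht (H.hcont_ux.mono hs)
    (H.hcont_uxt.mono hs) fun ξ hξ => H.huxt ξ ⟨hξ.1, hξ.2.trans hx.2⟩
  have ht' := Ioo_subset_Icc_self ht
  have hn := Icc_mem_nhds ht.1 ht.2
  rw [← hpde x hx t ht', ← hpde 0 h0 t ht']
  refine h1.unique ((((H.hut x hx t ht').hasDerivAt hn).sub
    ((H.hut 0 h0 t ht').hasDerivAt hn)).congr_of_eventuallyEq ?_)
  filter_upwards [hn] with τ hτ using H.integral_ux_s1 hτ le_rfl hx.1 hx.2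

theorem uxt_eq_uxxx {t x : ℝ} (ht : t ∈ Ioo 0 T) (hx : x ∈ Ioo (0 : ℝ) 1)
    (hpde : ∀ ξ ∈ Icc (0 : ℝ) 1, ∀ t ∈ Icc (0 : ℝ) T, H.ut ξ t = H.uxx ξ t) :
    H.uxt x t = H.uxxx x t := by
  have ht' := Ioo_subset_Icc_self ht
  have hn := Icc_mem_nhds hx.1 hx.2
  have hc := continuousOn_left_of_prod H.hcont_uxt ht'
  have h1 : HasDerivAt (fun z => ∫ ξ in (0 : ℝ)..z, H.uxt ξ t) (H.uxt x t) x := by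
    refine intervalIntegral.integral_hasDerivAt_right
      ((hc.mono ?_).intervalIntegrable) ?_ (hc.continuousAt hn)
    · rw [uIcc_of_le hx.1.le]
      exact Icc_subset_Icc_right hx.2.le
    · exact (hc.mono Ioo_subset_Icc_self).stronglyMeasurableAtFilter isOpen_Ioo x hx
  have h2 := ((H.huxxx t ht' x (Ioo_subset_Icc_self hx)).hasDerivAt hn).sub_const (H.uxx 0 t)
  refine h1.unique (h2.congr_of_eventuallyEq ?_)
  filter_upwards [hn] with z hz using H.integral_uxt_s1 ht hz hpde

theorem uxx_eq_zero_of_boundary {t x : ℝ} (ht : t ∈ Ioo 0 T) (hx : x ∈ Icc (0 : ℝ) 1)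
    (hpde : ∀ ξ ∈ Icc (0 : ℝ) 1, ∀ t ∈ Icc (0 : ℝ) T, H.ut ξ t = H.uxx ξ t)
    (h0 : ∀ t ∈ Icc 0 T, H.u x t = 0) : H.uxx x t = 0 := by
  have hn := Icc_mem_nhds ht.1 ht.2
  have ht' := Ioo_subset_Icc_self ht
  rw [← hpde x hx t ht']
  refine ((H.hut x hx t ht').hasDerivAt hn).unique
    ((hasDerivAt_const t (0 : ℝ)).congr_of_eventuallyEq ?_)
  filter_upwards [hn] with τ hτ using h0 τ hτ

theorem hasDerivAt_integral_ux_sq {t : ℝ} (ht : t ∈ Ioo 0 T)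
    (hpde : ∀ ξ ∈ Icc (0 : ℝ) 1, ∀ t ∈ Icc (0 : ℝ) T, H.ut ξ t = H.uxx ξ t)
    (h0 : H.uxx 0 t = 0) (h1 : H.uxx 1 t = 0) :
    HasDerivAt (fun τ => ∫ ξ in (0 : ℝ)..1, H.ux ξ τ ^ 2)
      (-2 * ∫ ξ in (0 : ℝ)..1, H.uxx ξ t ^ 2) t := by
  have ht' := Ioo_subset_Icc_self ht
  have h := hasDerivAt_intervalIntegral_of_continuousOn (f := fun ξ τ => H.ux ξ τ ^ 2)
    (f' := fun ξ τ => 2 * H.ux ξ τ * H.uxt ξ τ) zero_le_one ht (H.hcont_ux.pow 2)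
    ((continuousOn_const.mul H.hcont_ux).mul H.hcont_uxt) fun ξ hξ τ hτ => by
      exact ((H.huxt ξ hξ τ hτ).pow 2).congr_deriv (by simp)
  convert h using 1
  have hx := continuousOn_left_of_prod H.hcont_ux ht'
  have hxx := continuousOn_left_of_prod H.hcont_uxx ht'
  have hxxx := continuousOn_left_of_prod H.hcont_uxxx ht'
  have hI : uIcc (0 : ℝ) 1 = Icc 0 1 := uIcc_of_le zero_le_one
  have hparts := intervalIntegral.integral_mul_deriv_eq_deriv_mul_of_hasDerivAt
    (u := fun ξ => H.ux ξ t) (v := fun ξ => H.uxx ξ t) (u' := fun ξ => H.uxx ξ t)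
    (v' := fun ξ => H.uxxx ξ t) (a := 0) (b := 1) (by rwa [hI]) (by rwa [hI])
    (fun ξ hξ => by
      rw [min_eq_left zero_le_one, max_eq_right zero_le_one] at hξ
      exact (H.huxx t ht' ξ (Ioo_subset_Icc_self hξ)).hasDerivAt (Icc_mem_nhds hξ.1 hξ.2))
    (fun ξ hξ => by
      rw [min_eq_left zero_le_one, max_eq_right zero_le_one] at hξ
      exact (H.huxxx t ht' ξ (Ioo_subset_Icc_self hξ)).hasDerivAt (Icc_mem_nhds hξ.1 hξ.2))
    (ContinuousOn.intervalIntegrable (by rwa [hI])) (ContinuousOn.intervalIntegrable (by rwa [hI]))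
  have hcongr : ∫ ξ in (0 : ℝ)..1, 2 * H.ux ξ t * H.uxt ξ t =
      ∫ ξ in (0 : ℝ)..1, 2 * (H.ux ξ t * H.uxxx ξ t) :=
    intervalIntegral.integral_congr_Ioo_of_le zero_le_one fun ξ hξ => by
      simp only [H.uxt_eq_uxxx ht hξ hpde, mul_assoc]
  rw [hcongr, intervalIntegral.integral_const_mul, hparts, h0, h1]
  simp [sq]

/-- The sup norm of `u_xxx` in space depends continuously on time. -/
theorem continuousOn_iSup_uxxx :
    ContinuousOn (fun τ => ⨆ ξ : Icc (0 : ℝ) 1, |H.uxxx (ξ : ℝ) τ|) (Icc 0 T) := by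
  rw [continuousOn_iff_continuous_domRestrict]
  have h : Continuous (fun q : Icc (0 : ℝ) T × Icc (0 : ℝ) 1 => |H.uxxx q.2 q.1|) :=
    (H.hcont_uxxx.comp_continuous (f := fun q : Icc (0 : ℝ) T × Icc (0 : ℝ) 1 =>
      ((q.2 : ℝ), (q.1 : ℝ))) (by fun_prop) fun q => ⟨q.2.2, q.1.2⟩).abs
  have := isCompact_univ.continuous_sSup (f := fun (τ : Icc (0 : ℝ) T) (ξ : Icc (0 : ℝ) 1) =>
    |H.uxxx ξ τ|) h
  simp only [image_univ] at this
  exact this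

theorem abs_uxx_sub_le {t a b : ℝ} (ht : t ∈ Icc 0 T) (ha : 0 ≤ a) (hab : a ≤ b) (hb : b ≤ 1) :
    |H.uxx b t - H.uxx a t| ≤ (⨆ ξ : Icc (0 : ℝ) 1, |H.uxxx (ξ : ℝ) t|) * (b - a) := by
  have hbdd : BddAbove (range fun ξ : Icc (0 : ℝ) 1 => |H.uxxx (ξ : ℝ) t|) :=
    isCompact_range
      (continuousOn_left_of_prod H.hcont_uxxx ht).domRestrict.abs |>.bddAbove
  have := (convex_Icc (0 : ℝ) 1).norm_image_sub_le_of_norm_hasDerivWithin_le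
    (f := fun ξ => H.uxx ξ t) (fun ξ hξ => H.huxxx t ht ξ hξ)
    (fun ξ hξ => le_ciSup hbdd ⟨ξ, hξ⟩) ⟨ha, hab.trans hb⟩ ⟨ha.trans hab, hb⟩
  simpa only [Real.norm_eq_abs, abs_of_nonneg (sub_nonneg.2 hab)] using this

end C3Sol

namespace CrystSol

variable {I : Set ℝ} (S : CrystSol I)

theorem x_le_x {t : ℝ} (ht : t ∈ I) {i j : ℕ} (hij : i ≤ j) (hj : j ≤ S.N) :
    S.x i t ≤ S.x j t := by
  induction j, hij using Nat.le_induction with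
  | base => exact le_rfl
  | succ k _ ih => exact (ih (by omega)).trans (S.hmono t ht k hj).le

theorem x_mem_Icc {t : ℝ} (ht : t ∈ I) {k : ℕ} (hk : k ≤ S.N) : S.x k t ∈ Icc (0 : ℝ) 1 :=
  ⟨(S.hx0 t ht).symm.le.trans (S.x_le_x ht (Nat.zero_le k) hk),
    (S.x_le_x ht hk le_rfl).trans (S.hxN t ht).le⟩

theorem x_mem_Ioo {t : ℝ} (ht : t ∈ I) {k : ℕ} (h0 : k ≠ 0) (hk : k < S.N) :
    S.x k t ∈ Ioo (0 : ℝ) 1 := by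
  obtain ⟨i, rfl⟩ := Nat.exists_eq_succ_of_ne_zero h0
  exact ⟨(S.x_mem_Icc ht (by omega : i ≤ S.N)).1.trans_lt (S.hmono t ht i hk.le),
    (S.hmono t ht (i + 1) hk).trans_le (S.x_mem_Icc ht hk).2⟩

theorem sum_length {t : ℝ} (ht : t ∈ I) :
    ∑ k ∈ Finset.range S.N, (S.x (k + 1) t - S.x k t) = 1 := by
  rw [Finset.sum_range_sub (fun k => S.x k t), S.hxN t ht, S.hx0 t ht, sub_zero]

/-- An integral over `[0, 1]` of a function that is given by a continuous function on the interior
of each face splits into the integrals over the faces. -/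
theorem integral_eq_sum_faces {t : ℝ} (ht : t ∈ I) {f : ℝ → ℝ} {g : ℕ → ℝ → ℝ}
    (hg : ∀ k < S.N, ContinuousOn (g k) (Icc 0 1))
    (hfg : ∀ k < S.N, ∀ ξ ∈ Ioo (S.x k t) (S.x (k + 1) t), f ξ = g k ξ) :
    ∫ ξ in (0 : ℝ)..1, f ξ =
      ∑ k ∈ Finset.range S.N, ∫ ξ in S.x k t..S.x (k + 1) t, g k ξ := by
  have hint : ∀ k < S.N, IntervalIntegrable f volume (S.x k t) (S.x (k + 1) t) := by
    intro k hk
    have hle := (S.hmono t ht k hk).le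
    refine IntervalIntegrable.congr_uIoo (ContinuousOn.intervalIntegrable ((hg k hk).mono ?_)) ?_
    · rw [uIcc_of_le hle]
      exact Icc_subset_Icc (S.x_mem_Icc ht hk.le).1 (S.x_mem_Icc ht hk).2
    · rw [uIoo_of_le hle]
      exact fun ξ hξ => (hfg k hk ξ hξ).symm
  have h := intervalIntegral.sum_integral_adjacent_intervals hint
  rw [S.hx0 t ht, S.hxN t ht] at h
  rw [← h]
  refine Finset.sum_congr rfl fun k hk => ?_
  rw [Finset.mem_range] at hk
  exact intervalIntegral.integral_congr_Ioo_of_le (S.hmono t ht k hk).le (hfg k hk)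

end CrystSol

/-- The squared slope error in terms of `u_x` and the values of `u` at the corners. -/
theorem integral_slope_error_sq {T : ℝ} (H : C3Sol T) {I : Set ℝ} (S : CrystSol I)
    {uxm : ℝ → ℝ → ℝ} (hslope : SlopeLink S uxm) {t : ℝ} (ht : t ∈ I) (htT : t ∈ Icc 0 T) :
    ∫ ξ in (0 : ℝ)..1, (H.ux ξ t - uxm ξ t) ^ 2 =
      (∫ ξ in (0 : ℝ)..1, H.ux ξ t ^ 2)
        - 2 * ∑ k ∈ Finset.range S.N,
          S.s (k + 1) * (H.u (S.x (k + 1) t) t - H.u (S.x k t) t)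
        + ∑ k ∈ Finset.range S.N, S.s (k + 1) ^ 2 * (S.x (k + 1) t - S.x k t) := by
  have hc := continuousOn_left_of_prod H.hcont_ux htT
  rw [S.integral_eq_sum_faces ht (f := fun ξ => (H.ux ξ t - uxm ξ t) ^ 2)
      (g := fun k ξ => (H.ux ξ t - S.s (k + 1)) ^ 2)
      (fun k _ => (hc.sub continuousOn_const).pow 2)
      (fun k hk ξ hξ => by simp only [hslope t ht (k + 1) (by omega) hk ξ hξ]),
    S.integral_eq_sum_faces ht (f := fun ξ => H.ux ξ t ^ 2) (g := fun _ ξ => H.ux ξ t ^ 2)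
      (fun k _ => hc.pow 2) (fun _ _ _ _ => rfl),
    Finset.mul_sum, ← Finset.sum_sub_distrib, ← Finset.sum_add_distrib]
  refine Finset.sum_congr rfl fun k hk => ?_
  rw [Finset.mem_range] at hk
  have hle := (S.hmono t ht k hk).le
  have h0 := (S.x_mem_Icc ht hk.le).1
  have h1 := (S.x_mem_Icc ht hk).2
  have hc' : ContinuousOn (fun ξ => H.ux ξ t) (uIcc (S.x k t) (S.x (k + 1) t)) := by
    rw [uIcc_of_le hle]
    exact hc.mono (Icc_subset_Icc h0 h1)
  have hexp : ∀ ξ, (H.ux ξ t - S.s (k + 1)) ^ 2 =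
      H.ux ξ t ^ 2 - 2 * S.s (k + 1) * H.ux ξ t + S.s (k + 1) ^ 2 := fun ξ => by ring
  simp only [hexp]
  have i1 : IntervalIntegrable (fun ξ => H.ux ξ t ^ 2) volume (S.x k t) (S.x (k + 1) t) :=
    (hc'.pow 2).intervalIntegrable
  have i2 : IntervalIntegrable (fun ξ => 2 * S.s (k + 1) * H.ux ξ t) volume
      (S.x k t) (S.x (k + 1) t) := (continuousOn_const.mul hc').intervalIntegrable
  rw [intervalIntegral.integral_add (i1.sub i2) (by simp),
    intervalIntegral.integral_sub i1 i2, intervalIntegral.integral_const_mul,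
    H.integral_ux_s1 htT h0 hle h1, intervalIntegral.integral_const, smul_eq_mul]
  ring

/-- The squared slope error grows at most at the rate `m * ‖u_xxx‖_∞`. -/
theorem exists_hasDerivAt_slope_error_sq {T m a b : ℝ} (H : C3Sol T)
    (hpde : ∀ ξ ∈ Icc (0 : ℝ) 1, ∀ t ∈ Icc (0 : ℝ) T, H.ut ξ t = H.uxx ξ t)
    (hbc : ∀ t ∈ Icc (0 : ℝ) T, H.u 0 t = 0 ∧ H.u 1 t = 0)
    {uxm : ℝ → ℝ → ℝ} (hab : Ioo a b ⊆ Ioo 0 T) (S : CrystSol (Ioo a b))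
    (hslope : SlopeLink S uxm) (hs0 : S.s 0 = S.s 2) (hsN : S.s (S.N + 1) = S.s (S.N - 1))
    (hv0 : ∀ t ∈ Ioo a b, S.v 1 t = 0 ∧ S.v S.N t = 0)
    (hv : ∀ t ∈ Ioo a b, ∀ i, 2 ≤ i → i ≤ S.N - 1 →
      S.v i t = (S.s (i + 1) - S.s (i - 1)) / (2 * S.len i t))
    (hm : ∀ i, 1 ≤ i → i ≤ S.N + 1 → |S.s i - S.s (i - 1)| ≤ m)
    {t : ℝ} (ht : t ∈ Ioo a b) :
    ∃ D, HasDerivAt (fun τ => ∫ ξ in (0 : ℝ)..1, (H.ux ξ τ - uxm ξ τ) ^ 2) D t ∧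
      D ≤ m * ⨆ ξ : Icc (0 : ℝ) 1, |H.uxxx (ξ : ℝ) t| := by
  obtain ⟨M, hN, hM⟩ : ∃ M, S.N = M + 1 ∧ 1 ≤ M := ⟨S.N - 1, by have := S.hN; omega⟩
  have htT := hab ht
  have htT' := Ioo_subset_Icc_self htT
  have hn : Ioo a b ∈ nhds t := Ioo_mem_nhds ht.1 ht.2
  have hA0 : H.uxx 0 t = 0 :=
    H.uxx_eq_zero_of_boundary htT (by simp) hpde fun τ hτ => (hbc τ hτ).1
  have hA1 : H.uxx 1 t = 0 :=
    H.uxx_eq_zero_of_boundary htT (by simp) hpde fun τ hτ => (hbc τ hτ).2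
  obtain ⟨w, hw0, hwN, hw⟩ : ∃ w : ℕ → ℝ, w 0 = 0 ∧ w (M + 1) = 0 ∧ ∀ k, k ≠ 0 → k ≠ M + 1 →
      w k = -((S.v (k + 1) t - S.v k t) / (S.s (k + 1) - S.s k)) :=
    ⟨fun k => if k = 0 ∨ k = M + 1 then 0 else
      -((S.v (k + 1) t - S.v k t) / (S.s (k + 1) - S.s k)), by simp, by simp, fun k h0 h1 => by
        simp [h0, h1]⟩
  have hx : ∀ k ≤ S.N, HasDerivAt (S.x k) (w k) t := by
    intro k hk
    rcases eq_or_ne k 0 with rfl | h0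
    · rw [hw0]
      refine (hasDerivAt_const t (0 : ℝ)).congr_of_eventuallyEq ?_
      filter_upwards [hn] with τ hτ using S.hx0 τ hτ
    rcases eq_or_ne k (M + 1) with rfl | h1
    · rw [hwN]
      refine (hasDerivAt_const t (1 : ℝ)).congr_of_eventuallyEq ?_
      filter_upwards [hn] with τ hτ
      rw [← hN, S.hxN τ hτ]
    rw [hw k h0 h1]
    exact (S.hcorner t ht k (by omega) (by omega)).hasDerivAt hn
  have hu : ∀ k ≤ S.N, HasDerivAt (fun τ => H.u (S.x k τ) τ)
      (H.ux (S.x k t) t * w k + H.uxx (S.x k t) t) t := by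
    intro k hk
    rcases eq_or_ne k 0 with rfl | h0
    · rw [hw0, S.hx0 t ht, hA0, mul_zero, zero_add]
      refine (hasDerivAt_const t (0 : ℝ)).congr_of_eventuallyEq ?_
      filter_upwards [hn] with τ hτ
      rw [S.hx0 τ hτ, (hbc τ (Ioo_subset_Icc_self (hab hτ))).1]
    rcases eq_or_ne k (M + 1) with rfl | h1
    · rw [hwN, ← hN, S.hxN t ht, hA1, mul_zero, zero_add]
      refine (hasDerivAt_const t (0 : ℝ)).congr_of_eventuallyEq ?_
      filter_upwards [hn] with τ hτ
      rw [S.hxN τ hτ, (hbc τ (Ioo_subset_Icc_self (hab hτ))).2]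
    rw [← hpde _ (S.x_mem_Icc ht hk) t htT']
    exact hasDerivAt_comp_moving_point htT (S.x_mem_Ioo ht h0 (by omega)) (hx k hk)
      H.hcont_ux H.hcont_ut H.hux H.hut
  have hlen : ∀ k ≤ M, 0 < S.x (k + 1) t - S.x k t := fun k hk =>
    sub_pos.2 (S.hmono t ht k (by omega))
  have hV0 : S.v (0 + 1) t = 0 := (hv0 t ht).1
  have hVM : S.v (M + 1) t = 0 := by rw [← hN]; exact (hv0 t ht).2
  have hVl : ∀ k ≤ M, S.v (k + 1) t * (S.x (k + 1) t - S.x k t) =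
      (S.s (k + 2) - S.s k) / 2 := by
    intro k hk
    rcases eq_or_ne k 0 with rfl | h0
    · rw [hV0, hs0]; simp
    rcases eq_or_ne k M with rfl | h1
    · rw [hN, Nat.add_sub_cancel] at hsN
      rw [hVM, show k + 2 = k + 1 + 1 from rfl, hsN]; simp
    have := (hlen k hk).ne'
    rw [hv t ht (k + 1) (by omega) (by omega), CrystSol.len, Nat.add_sub_cancel]
    field_simp
  -- an intermediate point of each face at which `u_xx` equals its mean over the face
  have hc : ∀ k ≤ M, ∃ c ∈ Icc (S.x k t) (S.x (k + 1) t),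
      (k = 0 ∨ k = M → H.uxx c t = 0) ∧
      S.v (k + 1) t * (H.ux (S.x (k + 1) t) t - H.ux (S.x k t) t) =
        (S.s (k + 2) - S.s k) / 2 * H.uxx c t := by
    intro k hk
    have hle := sub_pos.1 (hlen k hk)
    rcases eq_or_ne k 0 with rfl | h0
    · refine ⟨S.x 0 t, left_mem_Icc.2 hle.le, fun _ => by rwa [S.hx0 t ht], ?_⟩
      rw [← hVl 0 hk, hV0]; simp
    rcases eq_or_ne k M with rfl | h1
    · refine ⟨S.x (k + 1) t, right_mem_Icc.2 hle.le, fun _ => by rwa [← hN, S.hxN t ht], ?_⟩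
      rw [← hVl k hk, hVM]; simp
    have hsub : Icc (S.x k t) (S.x (k + 1) t) ⊆ Icc 0 1 :=
      Icc_subset_Icc (S.x_mem_Icc ht (by omega)).1 (S.x_mem_Icc ht (by omega)).2
    obtain ⟨c, hc, hceq⟩ := exists_hasDerivAt_eq_slope (fun ξ => H.ux ξ t) (fun ξ => H.uxx ξ t)
      hle ((continuousOn_left_of_prod H.hcont_ux htT').mono hsub) fun ξ hξ =>
        (H.huxx t htT' ξ (hsub (Ioo_subset_Icc_self hξ))).hasDerivAt
          (Filter.mem_of_superset (Icc_mem_nhds hξ.1 hξ.2) hsub)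
    refine ⟨c, Ioo_subset_Icc_self hc, fun h => by omega, ?_⟩
    have := (hlen k hk).ne'
    rw [hceq, ← hVl k hk]
    field_simp
  choose! c hcI hc0 hcV using hc
  set K := ⨆ ξ : Icc (0 : ℝ) 1, |H.uxxx (ξ : ℝ) t| with hK
  have huxx := continuousOn_left_of_prod H.hcont_uxx htT'
  have halg := crystal_rate_le (M := M) hM (s := S.s) (V := fun k => S.v (k + 1) t) (w := w)
    (P := fun k => H.ux (S.x k t) t) (A := fun k => H.uxx (S.x k t) t)
    (l := fun k => S.x (k + 1) t - S.x k t) (B := fun k => H.uxx (c k) t)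
    (Q := fun k => ∫ ξ in S.x k t..S.x (k + 1) t, H.uxx ξ t ^ 2) (m := m) (K := K)
    hw0 hwN
    (fun i hi => by
      have h := sub_ne_zero.2 (S.hs (i + 1) (by omega) (by omega)).symm
      rw [hw (i + 1) (by omega) (by omega), mul_neg, mul_div_cancel₀ _ h])
    hV0 hVM hVl (by simpa only [S.hx0 t ht] using hA0)
    (by simpa only [← hN, S.hxN t ht] using hA1)
    (fun k hk => by
      have h1 := H.abs_uxx_sub_le htT'
        ((S.x_mem_Icc ht (by omega : k ≤ S.N)).1.trans (hcI k hk).1) (hcI k hk).2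
        (S.x_mem_Icc ht (by omega)).2
      have h2 := H.abs_uxx_sub_le htT' (S.x_mem_Icc ht (by omega : k ≤ S.N)).1 (hcI k hk).1
        ((hcI k hk).2.trans (S.x_mem_Icc ht (by omega)).2)
      rw [abs_sub_comm] at h2
      linarith)
    (hc0 0 (Nat.zero_le M) (Or.inl rfl)) (hc0 M le_rfl (Or.inr rfl)) hcV
    (fun k hk => by
      have hle := (sub_pos.1 (hlen k hk)).le
      have hsub : Icc (S.x k t) (S.x (k + 1) t) ⊆ Icc 0 1 :=
        Icc_subset_Icc (S.x_mem_Icc ht (by omega)).1 (S.x_mem_Icc ht (by omega)).2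
      have hcx := huxx.mono hsub
      have hux : ∫ ξ in S.x k t..S.x (k + 1) t, H.uxx ξ t =
          H.ux (S.x (k + 1) t) t - H.ux (S.x k t) t :=
        intervalIntegral.integral_eq_sub_of_hasDerivAt_of_le hle
          ((continuousOn_left_of_prod H.hcont_ux htT').mono hsub)
          (fun ξ hξ => (H.huxx t htT' ξ (hsub (Ioo_subset_Icc_self hξ))).hasDerivAt
            (Filter.mem_of_superset (Icc_mem_nhds hξ.1 hξ.2) hsub))
          (ContinuousOn.intervalIntegrable (by rwa [uIcc_of_le hle]))
      have hi1 : IntervalIntegrable (fun ξ => 2 * S.v (k + 1) t * H.uxx ξ t) volume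
          (S.x k t) (S.x (k + 1) t) := ContinuousOn.intervalIntegrable <| by
        rw [uIcc_of_le hle]; exact continuousOn_const.mul hcx
      have hi2 : IntervalIntegrable (fun ξ => H.uxx ξ t ^ 2) volume
          (S.x k t) (S.x (k + 1) t) := ContinuousOn.intervalIntegrable <| by
        rw [uIcc_of_le hle]; exact hcx.pow 2
      have hmono := intervalIntegral.integral_mono_on hle
        (hi1.sub (_root_.intervalIntegrable_const (c := S.v (k + 1) t ^ 2))) hi2
        fun ξ _ => by nlinarith [sq_nonneg (H.uxx ξ t - S.v (k + 1) t)]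
      rw [intervalIntegral.integral_sub hi1 (by simp), intervalIntegral.integral_const_mul, hux,
        intervalIntegral.integral_const, smul_eq_mul] at hmono
      linarith)
    (by rw [← hN]; exact S.sum_length ht)
    (fun i hi => hm (i + 2) (by omega) (by omega))
  have hderiv := ((H.hasDerivAt_integral_ux_sq htT hpde hA0 hA1).sub
    ((HasDerivAt.fun_sum (u := Finset.range S.N) fun k hk =>
      (((hu (k + 1) (Finset.mem_range.1 hk)).sub
        (hu k (Finset.mem_range.1 hk).le)).const_mul (S.s (k + 1)))).const_mul 2)).add
    (HasDerivAt.fun_sum (u := Finset.range S.N) fun k hk =>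
      ((hx (k + 1) (Finset.mem_range.1 hk)).sub
        (hx k (Finset.mem_range.1 hk).le)).const_mul (S.s (k + 1) ^ 2))
  refine ⟨_, hderiv.congr_of_eventuallyEq ?_, ?_⟩
  · filter_upwards [hn] with τ hτ
      using integral_slope_error_sq H S hslope hτ (Ioo_subset_Icc_self (hab hτ))
  · rw [S.integral_eq_sum_faces ht (f := fun ξ => H.uxx ξ t ^ 2) (g := fun _ ξ => H.uxx ξ t ^ 2)
      (fun k _ => huxx.pow 2) (fun _ _ _ _ => rfl), hN]
    have hsplit : ∑ k ∈ Finset.range (M + 1), S.s (k + 1) *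
        (H.ux (S.x (k + 1) t) t * w (k + 1) + H.uxx (S.x (k + 1) t) t -
          (H.ux (S.x k t) t * w k + H.uxx (S.x k t) t)) =
        ∑ k ∈ Finset.range (M + 1), S.s (k + 1) *
          (H.uxx (S.x (k + 1) t) t - H.uxx (S.x k t) t) +
        ∑ k ∈ Finset.range (M + 1), S.s (k + 1) *
          (H.ux (S.x (k + 1) t) t * w (k + 1) - H.ux (S.x k t) t * w k) := by
      rw [← Finset.sum_add_distrib]
      exact Finset.sum_congr rfl fun k _ => by ring
    rw [hsplit]
    linarith

theorem le_of_lt_succ_upto {part : ℕ → ℝ} {J : ℕ} (h : ∀ j < J, part j < part (j + 1)) {i j : ℕ}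
    (hij : i ≤ j) (hj : j ≤ J) : part i ≤ part j := by
  induction j, hij using Nat.le_induction with
  | base => exact le_rfl
  | succ k _ ih => exact (ih (by omega)).trans (h k hj).le

/-- A continuous function whose derivative is nonpositive off the points of a partition is
bounded by its initial value. -/
theorem le_left_of_deriv_nonpos_on_partition {G : ℝ → ℝ} {T : ℝ} {J : ℕ} {part : ℕ → ℝ}
    (hG : ContinuousOn G (Icc (part 0) T)) (hT : part J = T)
    (hmono : ∀ j < J, part j < part (j + 1))
    (hderiv : ∀ j < J, ∀ t ∈ Ioo (part j) (part (j + 1)), ∃ D, HasDerivAt G D t ∧ D ≤ 0) :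
    ∀ t ∈ Icc (part 0) T, G t ≤ G (part 0) := by
  have hle := fun i j => le_of_lt_succ_upto (i := i) (j := j) hmono
  have key : ∀ j ≤ J, ∀ t ∈ Icc (part 0) (part j), G t ≤ G (part 0) := by
    intro j
    induction j with
    | zero => exact fun _ t ht => by rw [le_antisymm ht.2 ht.1]
    | succ j ih =>
      intro hj t ht
      rcases le_total t (part j) with h | h
      · exact ih (by omega) t ⟨ht.1, h⟩
      have hanti : AntitoneOn G (Icc (part j) (part (j + 1))) := by
        refine antitoneOn_of_deriv_nonpos (convex_Icc _ _) (hG.mono (Icc_subset_Icc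
          (hle 0 j (Nat.zero_le j) (by omega)) (hT ▸ hle (j + 1) J hj le_rfl))) ?_ ?_
        · rw [interior_Icc]
          intro τ hτ
          obtain ⟨D, hD, -⟩ := hderiv j hj τ hτ
          exact hD.differentiableAt.differentiableWithinAt
        · rw [interior_Icc]
          intro τ hτ
          obtain ⟨D, hD, hD0⟩ := hderiv j hj τ hτ
          rwa [hD.deriv]
      exact (hanti (left_mem_Icc.2 (hmono j hj).le) ⟨h, ht.2⟩ h).trans
        (ih (by omega) _ (right_mem_Icc.2 (hle 0 j (Nat.zero_le j) (by omega))))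
  exact hT ▸ key J le_rfl

/-- Integrated error estimate for the crystalline approximation of the heat equation with
homogeneous Dirichlet boundary conditions:
`(1/2)∫₀¹ |u_x - u_x^m|²(t) ≤ (1/2) m² + (1/2) m ∫₀ᵗ ‖u_xxx(·,τ)‖_∞ dτ`. -/
theorem heat_error_integrated_estimate (T m : ℝ) (hT : 0 < T) (H : C3Sol T)
    (hpde : ∀ ξ ∈ Set.Icc (0:ℝ) 1, ∀ t ∈ Set.Icc (0:ℝ) T, H.ut ξ t = H.uxx ξ t)
    (hbc : ∀ t ∈ Set.Icc (0:ℝ) T, H.u 0 t = 0 ∧ H.u 1 t = 0)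
    (um uxm : ℝ → ℝ → ℝ)
    (humcont : ContinuousOn (fun q : ℝ × ℝ => um q.1 q.2) (Set.Icc 0 1 ×ˢ Set.Icc 0 T))
    (herrcont : ContinuousOn
      (fun t => ∫ ξ in (0:ℝ)..1, (H.ux ξ t - uxm ξ t) ^ 2) (Set.Icc 0 T))
    (J : ℕ) (hJ : 1 ≤ J) (part : ℕ → ℝ)
    (hpart0 : part 0 = 0) (hpartJ : part J = T)
    (hpartmono : ∀ j, j < J → part j < part (j + 1))
    (hsub : ∀ j, j < J → ∃ S : CrystSol (Set.Ioo (part j) (part (j + 1))),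
      UmLink S um ∧ SlopeLink S uxm ∧
      S.s 0 = S.s 2 ∧ S.s (S.N + 1) = S.s (S.N - 1) ∧
      (∀ t ∈ Set.Ioo (part j) (part (j + 1)), S.v 1 t = 0 ∧ S.v S.N t = 0) ∧
      (∀ t ∈ Set.Ioo (part j) (part (j + 1)), ∀ i, 2 ≤ i → i ≤ S.N - 1 →
        S.v i t = (S.s (i + 1) - S.s (i - 1)) / (2 * S.len i t)) ∧
      (∀ i, 1 ≤ i → i ≤ S.N + 1 → |S.s i - S.s (i - 1)| ≤ m))
    (hinit : ∀ ξ ∈ Set.Icc (0:ℝ) 1, |uxm ξ 0 - H.ux ξ 0| ≤ m) :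
    ∀ t ∈ Set.Icc (0:ℝ) T,
      (1 / 2) * ∫ ξ in (0:ℝ)..1, (H.ux ξ t - uxm ξ t) ^ 2 ≤
        (1 / 2) * m ^ 2 +
          (1 / 2) * m * ∫ τ in (0:ℝ)..t, ⨆ ξ : Set.Icc (0:ℝ) 1, |H.uxxx (ξ : ℝ) τ| := by
  have hpart_le := fun i j => le_of_lt_succ_upto (i := i) (j := j) hpartmono
  set K : ℝ → ℝ := fun τ => ⨆ ξ : Set.Icc (0:ℝ) 1, |H.uxxx (ξ : ℝ) τ| with hKdef
  have hK : ContinuousOn K (Icc 0 T) := H.continuousOn_iSup_uxxx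
  have hKint : ∀ t ∈ Icc 0 T, IntervalIntegrable K volume 0 t := fun t ht =>
    (hK.mono (by rw [uIcc_of_le ht.1]; exact Icc_subset_Icc_right ht.2)).intervalIntegrable
  have hprim : ContinuousOn (fun t => ∫ τ in (0:ℝ)..t, K τ) (Icc 0 T) := by
    have h := intervalIntegral.continuousOn_primitive_interval' (hKint T ⟨hT.le, le_rfl⟩)
      left_mem_uIcc
    rwa [uIcc_of_le hT.le] at h
  intro t ht
  have hmain := le_left_of_deriv_nonpos_on_partition
    (G := fun t => (∫ ξ in (0:ℝ)..1, (H.ux ξ t - uxm ξ t) ^ 2) - m * ∫ τ in (0:ℝ)..t, K τ)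
    (T := T) (J := J) (part := part)
    (by rw [hpart0]; exact herrcont.sub (continuousOn_const.mul hprim)) hpartJ hpartmono
    (fun j hj τ hτ => by
      obtain ⟨S, -, hslope, hs0, hsN, hv0, hv, hm⟩ := hsub j hj
      have hI : Ioo (part j) (part (j + 1)) ⊆ Ioo 0 T := Ioo_subset_Ioo
        (hpart0 ▸ hpart_le 0 j (Nat.zero_le j) hj.le) (hpartJ ▸ hpart_le (j + 1) J hj le_rfl)
      obtain ⟨D, hD, hDle⟩ :=
        exists_hasDerivAt_slope_error_sq H hpde hbc hI S hslope hs0 hsN hv0 hv hm hτ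
      have hτT := hI hτ
      have hKd : HasDerivAt (fun t => ∫ τ in (0:ℝ)..t, K τ) (K τ) τ :=
        intervalIntegral.integral_hasDerivAt_right (hKint τ (Ioo_subset_Icc_self hτT))
          ((hK.mono Ioo_subset_Icc_self).stronglyMeasurableAtFilter isOpen_Ioo τ hτT)
          (hK.continuousAt (Icc_mem_nhds hτT.1 hτT.2))
      exact ⟨_, hD.sub (hKd.const_mul m), sub_nonpos.2 hDle⟩)
    t (by rwa [hpart0])
  have h0 : ∫ ξ in (0:ℝ)..1, (H.ux ξ 0 - uxm ξ 0) ^ 2 ≤ m ^ 2 := by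
    have h := intervalIntegral.norm_integral_le_of_norm_le_const (a := 0) (b := 1)
      (f := fun ξ => (H.ux ξ 0 - uxm ξ 0) ^ 2) (C := m ^ 2) fun ξ hξ => by
        rw [uIoc_of_le zero_le_one] at hξ
        rw [Real.norm_of_nonneg (sq_nonneg _), ← sq_abs, abs_sub_comm]
        exact pow_le_pow_left₀ (abs_nonneg _) (hinit ξ (Ioc_subset_Icc_self hξ)) 2
    rw [sub_zero, abs_one, mul_one] at h
    exact (le_abs_self _).trans h
  simp only [hpart0, intervalIntegral.integral_same, mul_zero, sub_zero] at hmain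
  linarith
end

section
/- Let W : ℝ → ℝ be strictly convex and fix an index i with 2 ≤ i ≤ N−1 in a crystalline discrete solution whose face velocities satisfy v_j = √(1+s_j²) Δ_j / l_j for 2 ≤ j ≤ N−1 and v_1 = v_N = 0, and whose lengths satisfy the evolution law l̇_i = c_i⁰ v_i + c_i^{−1} v_{i−1} + c_i^{1} v_{i+1}, where c_i⁰ = 1/(s_i − s_{i−1}) + 1/(s_{i+1} − s_i), c_i^{−1} = −1/(s_i − s_{i−1}), c_i^{1} = −1/(s_{i+1} − s_i). Assume s_{i−1} < s_i < s_{i+1}, and that at a time t we have v_i(t) > 0, v_i(t) ≥ v_{i−1}(t), and v_i(t) ≥ v_{i+1}(t). Then (d/dt) v_i(t) ≤ 0. (This is the key step in the maximum principle for u_t^m: a positive maximum of the face velocities is non-increasing.) -/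
open Set MeasureTheory

/-- Key step of the maximum principle for `u_t^m`: at a positive maximum of the face
velocities over a face with `s_{i-1} < s_i < s_{i+1}`, the face velocity is
non-increasing. -/
theorem velocity_maximum_principle_step (W : ℝ → ℝ)
    (hconv : ∀ a b c : ℝ, a < b → b < c →
      (W b - W a) / (b - a) < (W c - W b) / (c - b))
    (p q : ℝ) (S : CrystSol (Set.Ioo p q))
    (i : ℕ) (hi2 : 2 ≤ i) (hiN : i ≤ S.N - 1)
    (hvlaw : ∀ t ∈ Set.Ioo p q, ∀ j, 2 ≤ j → j ≤ S.N - 1 →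
      S.v j t = Real.sqrt (1 + (S.s j) ^ 2) * secondDD W S.s j / S.len j t)
    (hbdry : ∀ t ∈ Set.Ioo p q, S.v 1 t = 0 ∧ S.v S.N t = 0)
    (hldot : ∀ t ∈ Set.Ioo p q, HasDerivAt (fun σ => S.len i σ)
      ((1 / (S.s i - S.s (i - 1)) + 1 / (S.s (i + 1) - S.s i)) * S.v i t
        + (-(1 / (S.s i - S.s (i - 1)))) * S.v (i - 1) t
        + (-(1 / (S.s (i + 1) - S.s i))) * S.v (i + 1) t) t)
    (hmono₁ : S.s (i - 1) < S.s i) (hmono₂ : S.s i < S.s (i + 1))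
    (t : ℝ) (ht : t ∈ Set.Ioo p q)
    (hpos : 0 < S.v i t)
    (hmax₁ : S.v (i - 1) t ≤ S.v i t) (hmax₂ : S.v (i + 1) t ≤ S.v i t)
    (d : ℝ) (hd : HasDerivAt (S.v i) d t) :
    d ≤ 0 := by
  have hlen : ∀ τ ∈ Set.Ioo p q, 0 < S.len i τ := fun τ hτ => by
    have h := S.hmono τ hτ (i - 1) (by omega)
    rw [Nat.sub_add_cancel (by omega)] at h
    exact sub_pos.mpr h
  have hconst : (S.v i * fun σ => S.len i σ) =ᶠ[nhds t]
      fun _ => Real.sqrt (1 + (S.s i) ^ 2) * secondDD W S.s i := by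
    filter_upwards [isOpen_Ioo.mem_nhds ht] with τ hτ
    rw [Pi.mul_apply, hvlaw τ hτ i hi2 hiN]
    exact div_mul_cancel₀ _ (hlen τ hτ).ne'
  have hprod := (hd.mul (hldot t ht)).unique ((hasDerivAt_const t _).congr_of_eventuallyEq hconst)
  have hleft : 0 ≤ 1 / (S.s i - S.s (i - 1)) * (S.v i t - S.v (i - 1) t) :=
    mul_nonneg (one_div_pos.mpr (sub_pos.mpr hmono₁)).le (sub_nonneg.mpr hmax₁)
  have hright : 0 ≤ 1 / (S.s (i + 1) - S.s i) * (S.v i t - S.v (i + 1) t) :=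
    mul_nonneg (one_div_pos.mpr (sub_pos.mpr hmono₂)).le (sub_nonneg.mpr hmax₂)
  have hgrow := mul_nonneg hpos.le (add_nonneg hleft hright)
  refine nonpos_of_mul_nonpos_left ?_ (hlen t ht)
  linarith
end

section
/- Let W : ℝ → ℝ be three times continuously differentiable with W''(y) > 0 for all y, and let K > 0. Set c₁ = min_{|y| ≤ K} √(1+y²) W''(y) and c₂ = (2/3) √(1+K²) max_{|y| ≤ K} |W'''(y)|. Then c₁ > 0, and for every m > 0 and all real numbers a < b < c in [−K, K] with c − b ≤ m and b − a ≤ m, one has √(1+b²) · [ (W(c) − W(b))/(c − b) − (W(b) − W(a))/(b − a) ] / ((c − a)/2) ≥ c₁ − c₂ m. -/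
open Set in
/-- Second-order Taylor expansion with Lagrange remainder, on either side of the base point. -/
theorem exists_taylor_two_lagrange {f : ℝ → ℝ} (hf : ContDiff ℝ 3 f) {x₀ x : ℝ} (hx : x₀ ≠ x) :
    ∃ ξ ∈ uIoo x₀ x, f x = f x₀ + deriv f x₀ * (x - x₀) + iteratedDeriv 2 f x₀ * (x - x₀) ^ 2 / 2 +
      iteratedDeriv 3 f ξ * (x - x₀) ^ 3 / 6 := by
  obtain ⟨ξ, hξ, h⟩ := taylor_mean_remainder_lagrange_iteratedDeriv (n := 2) hx
    (by norm_num; exact hf.contDiffOn)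
  have hu : UniqueDiffOn ℝ (uIcc x₀ x) := uniqueDiffOn_uIcc hx
  refine ⟨ξ, hξ, ?_⟩
  have h1 : iteratedDerivWithin 1 f (uIcc x₀ x) x₀ = deriv f x₀ := by
    rw [iteratedDerivWithin_eq_iteratedDeriv hu (hf.contDiffAt.of_le (by norm_num)) left_mem_uIcc,
      iteratedDeriv_one]
  have h2 : iteratedDerivWithin 2 f (uIcc x₀ x) x₀ = iteratedDeriv 2 f x₀ :=
    iteratedDerivWithin_eq_iteratedDeriv hu (hf.contDiffAt.of_le (by norm_num)) left_mem_uIcc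
  rw [taylorWithinEval_succ, taylorWithinEval_succ, taylor_within_zero_eval] at h
  norm_num [h1, h2, Nat.factorial] at h
  linarith

/-- The difference of the two one-sided difference quotients at `b`, divided by half the total
width, approximates the second derivative at `b` to first order in the step size. -/
theorem second_divided_difference_ge {f : ℝ → ℝ} (hf : ContDiff ℝ 3 f) {a b c m M : ℝ}
    (hab : a < b) (hbc : b < c) (hcm : c - b ≤ m) (ham : b - a ≤ m)
    (hM : ∀ y ∈ Set.Icc a c, |iteratedDeriv 3 f y| ≤ M) :
    iteratedDeriv 2 f b - M * m / 3 ≤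
      ((f c - f b) / (c - b) - (f b - f a) / (b - a)) / ((c - a) / 2) := by
  obtain ⟨ξ, hξ, hc⟩ := exists_taylor_two_lagrange hf hbc.ne
  obtain ⟨η, hη, ha⟩ := exists_taylor_two_lagrange hf hab.ne'
  rw [Set.uIoo_of_lt hbc] at hξ
  rw [Set.uIoo_of_gt hab] at hη
  have hr := neg_le_of_abs_le (hM ξ ⟨(hab.trans hξ.1).le, hξ.2.le⟩)
  have hs := le_of_abs_le (hM η ⟨hη.1.le, (hη.2.trans hbc).le⟩)
  have hM0 : 0 ≤ M := (abs_nonneg _).trans (hM b ⟨hab.le, hbc.le⟩)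
  generalize iteratedDeriv 3 f ξ = r at *
  generalize iteratedDeriv 3 f η = s at *
  obtain ⟨h, rfl⟩ : ∃ h, c = b + h := ⟨c - b, by ring⟩
  obtain ⟨k, rfl⟩ : ∃ k, a = b - k := ⟨b - a, by ring⟩
  have hh : 0 < h := by linarith
  have hk : 0 < k := by linarith
  have hhm : h ≤ m := by linarith
  have hkm : k ≤ m := by linarith
  have hrh : -(M * m * h) ≤ r * h ^ 2 := by
    nlinarith [mul_le_mul_of_nonneg_right hr (sq_nonneg h),
      mul_le_mul_of_nonneg_left hhm (mul_nonneg hM0 hh.le)]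
  have hsk : s * k ^ 2 ≤ M * m * k := by
    nlinarith [mul_le_mul_of_nonneg_right hs (sq_nonneg k),
      mul_le_mul_of_nonneg_left hkm (mul_nonneg hM0 hk.le)]
  have hquot : ((f (b + h) - f b) / (b + h - b) - (f b - f (b - k)) / (b - (b - k))) /
      ((b + h - (b - k)) / 2) =
      iteratedDeriv 2 f b + (r * h ^ 2 - s * k ^ 2) / (3 * (h + k)) := by
    rw [hc, ha, add_sub_cancel_left, sub_sub_cancel, show b + h - (b - k) = h + k by ring]
    field_simp
    ring
  have hrem : -(M * m / 3) ≤ (r * h ^ 2 - s * k ^ 2) / (3 * (h + k)) := by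
    rw [le_div_iff₀ (by positivity)]
    linarith
  linarith

/-- Uniform parabolicity of the discrete scheme: with `c₁` the minimum of
`√(1+y²) W''(y)` on `[-K,K]` and `c₂ = (2/3)√(1+K²) max |W'''|`, the discrete analogue of
`√(1+u_x²) W''(u_x)` is bounded below by `c₁ - c₂ m` for slopes in `[-K,K]` at distance
at most `m`. -/
theorem discrete_parabolicity (W : ℝ → ℝ) (hW : ContDiff ℝ 3 W)
    (hWpp : ∀ y : ℝ, 0 < iteratedDeriv 2 W y) (K : ℝ) (hK : 0 < K) (c₁ c₂ : ℝ)
    (hc₁ : c₁ = ⨅ y : Set.Icc (-K) K, Real.sqrt (1 + (y : ℝ) ^ 2) * iteratedDeriv 2 W (y : ℝ))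
    (hc₂ : c₂ = (2 / 3) * Real.sqrt (1 + K ^ 2) *
      ⨆ y : Set.Icc (-K) K, |iteratedDeriv 3 W (y : ℝ)|) :
    0 < c₁ ∧
      ∀ m : ℝ, 0 < m → ∀ a b c : ℝ, a < b → b < c →
        a ∈ Set.Icc (-K) K → b ∈ Set.Icc (-K) K → c ∈ Set.Icc (-K) K →
        c - b ≤ m → b - a ≤ m →
        c₁ - c₂ * m ≤ Real.sqrt (1 + b ^ 2) *
          (((W c - W b) / (c - b) - (W b - W a) / (b - a)) / ((c - a) / 2)) := by
  subst hc₁ hc₂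
  have hmem : (0 : ℝ) ∈ Set.Icc (-K) K := ⟨by linarith, hK.le⟩
  have : Nonempty (Set.Icc (-K) K) := ⟨⟨0, hmem⟩⟩
  have hcont2 : Continuous (iteratedDeriv 2 W) := hW.continuous_iteratedDeriv 2 (by norm_num)
  have hcont3 : Continuous (iteratedDeriv 3 W) := hW.continuous_iteratedDeriv 3 (by norm_num)
  have hcont : Continuous fun y : Set.Icc (-K) K =>
      Real.sqrt (1 + (y : ℝ) ^ 2) * iteratedDeriv 2 W (y : ℝ) := by fun_prop
  have hcontabs : Continuous fun y : Set.Icc (-K) K => |iteratedDeriv 3 W (y : ℝ)| := by fun_prop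
  constructor
  · obtain ⟨y, hy⟩ := (isCompact_range hcont).sInf_mem (Set.range_nonempty _)
    rw [iInf, ← hy]
    exact mul_pos (by positivity) (hWpp y)
  intro m hm a b c hab hbc ha hb hc hcm ham
  have hinf := ciInf_le (isCompact_range hcont).bddBelow ⟨b, hb⟩
  have hsup (y : ℝ) (hy : y ∈ Set.Icc (-K) K) :=
    le_ciSup (isCompact_range hcontabs).bddAbove ⟨y, hy⟩
  dsimp only at hinf hsup
  generalize (⨆ y : Set.Icc (-K) K, |iteratedDeriv 3 W (y : ℝ)|) = M at *
  have hM0 : 0 ≤ M := (abs_nonneg _).trans (hsup b hb)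
  have hsqrt : Real.sqrt (1 + b ^ 2) ≤ Real.sqrt (1 + K ^ 2) :=
    Real.sqrt_le_sqrt (by nlinarith [hb.1, hb.2])
  have hdiff := second_divided_difference_ge hW hab hbc hcm ham
    fun y hy => hsup y ⟨ha.1.trans hy.1, hy.2.trans hc.2⟩
  refine le_trans ?_ (mul_le_mul_of_nonneg_left hdiff (Real.sqrt_nonneg _))
  have hMm : 0 ≤ M * m := mul_nonneg hM0 hm.le
  nlinarith [mul_le_mul_of_nonneg_right hsqrt hMm, mul_nonneg (Real.sqrt_nonneg (1 + K ^ 2)) hMm]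
end
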